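/- Let M = SM(U) be a loopless and coloopless Schubert matroid on [n] of rank r. Then there exists a finite family N_1, …, N_m of matroids on [n], each of which is a direct sum of series-parallel matroids, such that (1) the indicator function of the relative interior of P(M) equals the sum over j = 1,…,m of the indicator functions of the relative interiors of P(N_j), as functions ℝ^n → ℤ, and (2) for every i ≥ 1, the number of indices j for which N_j has exactly i connected components equals the number of admissible Delannoy paths associated to SM(U) having exactly i−1 diagonal steps. -/

import Mathlib

open scoped Classical

namespace GPoly

/-- A step of a Delannoy path: east `+(1,0)`, north `+(0,1)` or diagonal `+(1,1)`. -/
inductive DStep : Type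
  | east : DStep
  | north : DStep
  | diag : DStep
  deriving DecidableEq

/-- Horizontal displacement of a step. -/
def DStep.dx : DStep → ℕ
  | .east => 1
  | .north => 0
  | .diag => 1

/-- Vertical displacement of a step. -/
def DStep.dy : DStep → ℕ
  | .east => 0
  | .north => 1
  | .diag => 1

/-- Position reached after the first `k` steps of `P`, starting at the point `s`. -/
def pathPos (s : ℕ × ℕ) (P : List DStep) (k : ℕ) : ℕ × ℕ :=
  (s.1 + ((P.take k).map DStep.dx).sum, s.2 + ((P.take k).map DStep.dy).sum)

/-- The Gale order: `U ≤ B` iff the increasing enumerations satisfy `u_ℓ ≤ b_ℓ`. -/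
def galeLe {α : Type*} [LinearOrder α] (U B : Finset α) : Prop :=
  List.Forall₂ (· ≤ ·) (U.sort (· ≤ ·)) (B.sort (· ≤ ·))

/-- Bases of the Schubert matroid `SM(U)` of rank `r` on `[n] = {1, …, n}`:
all `r`-subsets `B` of `[n]` with `U ≤ B` in the Gale order. -/
noncomputable def schubertBases (n r : ℕ) (U : Finset ℕ) : Finset (Finset ℕ) :=
  (Finset.Icc 1 n).powerset.filter fun B => B.card = r ∧ galeLe U B

/-- The point `p` lies weakly below the lattice path `path(U)`. -/
def belowPath (U : Finset ℕ) (p : ℕ × ℕ) : Prop :=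
  p.2 ≤ (U ∩ Finset.Icc 1 (p.1 + p.2)).card

/-- `path(U)` traverses the vertical unit segment from `(x, y)` to `(x, y+1)`
(by its north step number `x + y + 1`). -/
def uVertSeg (U : Finset ℕ) (x y : ℕ) : Prop :=
  x + y + 1 ∈ U ∧ (U ∩ Finset.Icc 1 (x + y + 1)).card = y + 1

/-- A Delannoy path associated to `SM(U)`: starts at `(1,1)`, ends at `(n-r, r)` and
stays weakly below `path(U)`. -/
def IsDelannoy (n r : ℕ) (U : Finset ℕ) (P : List DStep) : Prop :=
  pathPos (1, 1) P P.length = (n - r, r) ∧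
    ∀ k ≤ P.length, belowPath U (pathPos (1, 1) P k)

/-- Admissible Delannoy path associated to `SM(U)`. -/
def IsAdmissible (n r : ℕ) (U : Finset ℕ) (P : List DStep) : Prop :=
  IsDelannoy n r U P ∧
    ∀ (k : ℕ) (h : k < P.length),
      (P.get ⟨k, h⟩ = DStep.north →
        pathPos (1, 1) P (k + 1) = (n - r, r) ∨
          ¬ uVertSeg U (pathPos (1, 1) P k).1 (pathPos (1, 1) P k).2) ∧
      (P.get ⟨k, h⟩ = DStep.diag →
        belowPath U ((pathPos (1, 1) P k).1, (pathPos (1, 1) P k).2 + 1) ∧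
          ¬ uVertSeg U (pathPos (1, 1) P k).1 (pathPos (1, 1) P k).2)

/-- Number of diagonal steps of a path. -/
def diagCount (P : List DStep) : ℕ := (P.filter (· = DStep.diag)).length

/-- The set of indices (0-based) of the diagonal steps of `P`. -/
def diagIndices (P : List DStep) : Finset ℕ :=
  (Finset.range P.length).filter fun k => P.getD k DStep.east = DStep.diag

/-- Replace a diagonal step by a north step followed by an east step. -/
def expandNE : DStep → List DStep
  | DStep.diag => [DStep.north, DStep.east]
  | s => [s]

/-- Replace a diagonal step by an east step followed by a north step. -/
def expandEN : DStep → List DStep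
  | DStep.diag => [DStep.east, DStep.north]
  | s => [s]

/-- The full lattice path of `B_P`: an east step, a north step, then the steps of `P`
with each diagonal step replaced by a north step immediately followed by an east step. -/
def fullPath (P : List DStep) : List DStep :=
  DStep.east :: DStep.north :: (P.map expandNE).flatten

/-- The subset of `[n]` whose `path` is the given (diagonal-free) list of steps:
the set of (1-based) positions of the north steps. -/
def northSet (L : List DStep) : Finset ℕ :=
  ((Finset.range L.length).filter fun k => L.getD k DStep.east = DStep.north).image (· + 1)

/-- The basis `B_P` associated to a Delannoy path `P`. -/
def delannoyBasis (P : List DStep) : Finset ℕ := northSet (fullPath P)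

/-! ### Matroid notions for a family of bases -/

/-- `S` is independent for the basis family `ℬ`: it is contained in some basis. -/
def famIndep (ℬ : Finset (Finset ℕ)) (S : Finset ℕ) : Prop := ∃ B ∈ ℬ, S ⊆ B

/-- `C` is a circuit for the basis family `ℬ`: a minimal dependent set. -/
def famCircuit (ℬ : Finset (Finset ℕ)) (C : Finset ℕ) : Prop :=
  ¬ famIndep ℬ C ∧ ∀ C' ⊂ C, famIndep ℬ C'

/-- The dual basis family on the ground set `E`: complements of bases. -/
noncomputable def famDual (E : Finset ℕ) (ℬ : Finset (Finset ℕ)) : Finset (Finset ℕ) :=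
  ℬ.image fun B => E \ B

/-- `e ∉ B` is externally active: `e` is the smallest element of the unique circuit
contained in `B ∪ {e}`. -/
def ExtActive (E : Finset ℕ) (ℬ : Finset (Finset ℕ)) (B : Finset ℕ) (e : ℕ) : Prop :=
  e ∈ E ∧ e ∉ B ∧
    ∃ C, C ⊆ insert e B ∧ famCircuit ℬ C ∧ e ∈ C ∧ ∀ x ∈ C, e ≤ x

/-- `i ∈ B` is internally active: `i` is the smallest element of the unique cocircuit
contained in `(E ∖ B) ∪ {i}`. -/
def IntActive (E : Finset ℕ) (ℬ : Finset (Finset ℕ)) (B : Finset ℕ) (i : ℕ) : Prop :=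
  i ∈ B ∧
    ∃ C, C ⊆ insert i (E \ B) ∧ famCircuit (famDual E ℬ) C ∧ i ∈ C ∧ ∀ x ∈ C, i ≤ x

/-- External activity `e(B)`. -/
noncomputable def extAct (E : Finset ℕ) (ℬ : Finset (Finset ℕ)) (B : Finset ℕ) : ℕ :=
  (E.filter (ExtActive E ℬ B)).card

/-- Internal activity `i(B)`. -/
noncomputable def intAct (E : Finset ℕ) (ℬ : Finset (Finset ℕ)) (B : Finset ℕ) : ℕ :=
  (E.filter (IntActive E ℬ B)).card

/-- The statistic `α(B)`: the number of `i ∈ B` such that `B' = (B ∖ {i}) ∪ {i+1}`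
is a basis with `e(B') = e(B)` and `i(B') = i(B)`. -/
noncomputable def alphaStat (E : Finset ℕ) (ℬ : Finset (Finset ℕ)) (B : Finset ℕ) : ℕ :=
  (B.filter fun i =>
    insert (i + 1) (B.erase i) ∈ ℬ ∧
      extAct E ℬ (insert (i + 1) (B.erase i)) = extAct E ℬ B ∧
      intAct E ℬ (insert (i + 1) (B.erase i)) = intAct E ℬ B).card

/-- The rank function determined by a family of bases. -/
noncomputable def famRank (ℬ : Finset (Finset ℕ)) (A : Finset ℕ) : ℕ :=
  ℬ.sup fun B => (A ∩ B).card

/-- The β-invariant: `β(M) = (−1)^{rk(E)} Σ_{A ⊆ E} (−1)^{|A|} rk(A)`. -/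
noncomputable def betaInv (E : Finset ℕ) (ℬ : Finset (Finset ℕ)) : ℤ :=
  (-1) ^ famRank ℬ E * ∑ A ∈ E.powerset, (-1) ^ A.card * (famRank ℬ A : ℤ)

/-- `ℬ` is the collection of bases of a matroid with ground set `E`:
it is a nonempty family of subsets of `E` satisfying the basis exchange property. -/
def IsBasisFamily (E : Finset ℕ) (ℬ : Finset (Finset ℕ)) : Prop :=
  ℬ.Nonempty ∧ (∀ B ∈ ℬ, B ⊆ E) ∧
    ∀ B₁ ∈ ℬ, ∀ B₂ ∈ ℬ, ∀ x ∈ B₁ \ B₂, ∃ y ∈ B₂ \ B₁, insert y (B₁.erase x) ∈ ℬ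

/-- Two elements lie in a common component: they are equal or in a common circuit. -/
def connRel (ℬ : Finset (Finset ℕ)) (e f : ℕ) : Prop :=
  e = f ∨ ∃ C, famCircuit ℬ C ∧ e ∈ C ∧ f ∈ C

/-- The number of connected components of the matroid with bases `ℬ` on `E`. -/
noncomputable def numComponents (E : Finset ℕ) (ℬ : Finset (Finset ℕ)) : ℕ :=
  Set.ncard {S : Set ℕ | ∃ e ∈ E, S = {f | f ∈ E ∧ Relation.EqvGen (connRel ℬ) e f}}

/-- The matroid with bases `ℬ` on ground set `E` is connected. -/
def IsConnectedFam (E : Finset ℕ) (ℬ : Finset (Finset ℕ)) : Prop :=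
  E.Nonempty ∧ ∀ e ∈ E, ∀ f ∈ E, Relation.EqvGen (connRel ℬ) e f

/-- Series-parallel matroid: isomorphic to `U_{0,1}` or `U_{1,1}`
(a single loop or a single coloop), or connected with β-invariant `1`. -/
def IsSeriesParallel (E : Finset ℕ) (ℬ : Finset (Finset ℕ)) : Prop :=
  (E.card = 1 ∧ (ℬ = {∅} ∨ ℬ = {E})) ∨ (IsConnectedFam E ℬ ∧ betaInv E ℬ = 1)

/-- The bases of the restriction of the matroid with bases `ℬ` to the set `F`:
the maximal intersections of bases with `F`. -/
noncomputable def famRestrict (ℬ : Finset (Finset ℕ)) (F : Finset ℕ) : Finset (Finset ℕ) :=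
  (ℬ.image (· ∩ F)).filter fun S => ∀ T ∈ ℬ.image (· ∩ F), S ⊆ T → S = T

/-- The matroid with bases `ℬ` on `E` is a direct sum of series-parallel matroids. -/
def IsDirectSumOfSeriesParallel (E : Finset ℕ) (ℬ : Finset (Finset ℕ)) : Prop :=
  ∃ parts : Finset (Finset ℕ),
    (↑parts : Set (Finset ℕ)).PairwiseDisjoint id ∧
    parts.sup id = E ∧
    (∀ S ∈ parts, IsSeriesParallel S (famRestrict ℬ S)) ∧
    ℬ = E.powerset.filter fun B => ∀ S ∈ parts, B ∩ S ∈ famRestrict ℬ S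

/-! ### Base polytopes -/

/-- The indicator vector of `B ⊆ E`, as a point of `ℝ^E`. -/
noncomputable def basisVector (E : Finset ℕ) (B : Finset ℕ) : ↑E → ℝ :=
  fun e => if (e : ℕ) ∈ B then 1 else 0

/-- The base polytope of the matroid with bases `ℬ` on `E`:
the convex hull in `ℝ^E` of the indicator vectors of the bases. -/
noncomputable def basePolytope (E : Finset ℕ) (ℬ : Finset (Finset ℕ)) : Set (↑E → ℝ) :=
  convexHull ℝ (basisVector E '' (↑ℬ : Set (Finset ℕ)))

/-- The indicator function `ℝ^E → ℤ` of the base polytope. -/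
noncomputable def polyInd (E : Finset ℕ) (ℬ : Finset (Finset ℕ)) : (↑E → ℝ) → ℤ :=
  fun x => if x ∈ basePolytope E ℬ then 1 else 0

/-- The indicator function `ℝ^E → ℤ` of the relative interior of the base polytope. -/
noncomputable def relintInd (E : Finset ℕ) (ℬ : Finset (Finset ℕ)) : (↑E → ℝ) → ℤ :=
  fun x => if x ∈ intrinsicInterior ℝ (basePolytope E ℬ) then 1 else 0

/-! ### Cyclic flats and the cyclic chain lattice -/

/-- `F` is a flat of the matroid with bases `ℬ` on `E`. -/
def IsFlat (E : Finset ℕ) (ℬ : Finset (Finset ℕ)) (F : Finset ℕ) : Prop :=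
  F ⊆ E ∧ ∀ e ∈ E, famRank ℬ (insert e F) = famRank ℬ F → e ∈ F

/-- `F` is a cyclic flat: a flat whose restriction has no coloops. -/
def IsCyclicFlat (E : Finset ℕ) (ℬ : Finset (Finset ℕ)) (F : Finset ℕ) : Prop :=
  IsFlat E ℬ F ∧ ∀ e ∈ F, ¬ (∀ S ∈ famRestrict ℬ F, e ∈ S)

/-- The set of cyclic flats. -/
noncomputable def cyclicFlats (E : Finset ℕ) (ℬ : Finset (Finset ℕ)) : Finset (Finset ℕ) :=
  E.powerset.filter (IsCyclicFlat E ℬ)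

/-- A chain of cyclic flats containing the minimum and maximum of the lattice of
cyclic flats; these are the elements (other than the top `1̂`) of the cyclic
chain lattice. -/
def IsCyclicChain (E : Finset ℕ) (ℬ : Finset (Finset ℕ)) (C : Finset (Finset ℕ)) : Prop :=
  ↑C ⊆ (cyclicFlats E ℬ : Set (Finset ℕ)) ∧ IsChain (· ⊆ ·) (↑C : Set (Finset ℕ)) ∧
    (∃ F ∈ C, ∀ G ∈ cyclicFlats E ℬ, F ⊆ G) ∧
    (∃ F ∈ C, ∀ G ∈ cyclicFlats E ℬ, G ⊆ F)

/-- The set of chains of cyclic flats containing the minimum and the maximum. -/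
noncomputable def cyclicChains (E : Finset ℕ) (ℬ : Finset (Finset ℕ)) :
    Finset (Finset (Finset ℕ)) :=
  (cyclicFlats E ℬ).powerset.filter (IsCyclicChain E ℬ)

/-- The rank function `A ↦ min_{Z ∈ C} (rk_M(Z) + |A ∖ Z|)` associated to a chain `C`. -/
noncomputable def chainRank (ℬ : Finset (Finset ℕ)) (C : Finset (Finset ℕ))
    (A : Finset ℕ) : ℕ :=
  if h : C.Nonempty then C.inf' h fun Z => famRank ℬ Z + (A \ Z).card else A.card

/-- The bases of the matroid on `E` with rank function `rk`:
the subsets `B ⊆ E` with `rk B = |B| = rk E`. -/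
noncomputable def basesOfRank (E : Finset ℕ) (rk : Finset ℕ → ℕ) : Finset (Finset ℕ) :=
  E.powerset.filter fun B => rk B = B.card ∧ rk B = rk E

/-- The bases of the Schubert matroid `S_C` associated to a chain `C` of cyclic flats. -/
noncomputable def chainSchubert (E : Finset ℕ) (ℬ : Finset (Finset ℕ))
    (C : Finset (Finset ℕ)) : Finset (Finset ℕ) :=
  basesOfRank E (chainRank ℬ C)

/-- The point reached by `path(S)` after `k` steps. -/
def pathPoint (S : Finset ℕ) (k : ℕ) : ℕ × ℕ :=
  (k - (S ∩ Finset.Icc 1 k).card, (S ∩ Finset.Icc 1 k).card)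



/-! ### Relative interiors and integrality -/

theorem relint_gen {V ι : Type*} [NormedAddCommGroup V] [NormedSpace ℝ V]
    [FiniteDimensional ℝ V] [Finite ι] (f : ι → V →ₗ[ℝ] ℝ) (c : ι → ℝ) (P : ι → Prop)
    (Q : Set V) (hQ : ∀ x, x ∈ Q ↔ ∀ i, f i x ≤ c i ∧ (P i → f i x = c i))
    (x0 : V) (h0 : ∀ i, (¬ P i → f i x0 < c i) ∧ (P i → f i x0 = c i)) (x : V) :
    x ∈ intrinsicInterior ℝ Q ↔ ∀ i, (¬ P i → f i x < c i) ∧ (P i → f i x = c i) := by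
  have hc : ∀ i, Continuous (f i) := fun i => (f i).continuous_of_finiteDimensional
  have hst : ∀ z : V, (∀ i, (¬ P i → f i z < c i) ∧ (P i → f i z = c i)) → z ∈ Q := by
    intro z hz
    rw [hQ]
    intro i
    refine ⟨?_, (hz i).2⟩
    by_cases hp : P i
    · exact ((hz i).2 hp).le
    · exact ((hz i).1 hp).le
  have hx0 : x0 ∈ Q := hst x0 h0
  have haff : ∀ z ∈ affineSpan ℝ Q, ∀ i, P i → f i z = c i := by
    intro z hz i hp
    refine affineSpan_induction (p := fun z => f i z = c i) hz ?_ ?_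
    · intro w hw
      exact ((hQ w).1 hw i).2 hp
    · intro a u v w hu hv hw
      simp only [vsub_eq_sub, vadd_eq_add, map_add, map_smul, map_sub, hu, hv, hw]
      simp
  rw [mem_intrinsicInterior]
  constructor
  · rintro ⟨y, hy, rfl⟩ i
    have hyQ : (y : V) ∈ Q := interior_subset (s := ((↑) ⁻¹' Q : Set (affineSpan ℝ Q))) hy
    refine ⟨fun hp => ?_, fun hp => ((hQ _).1 hyQ i).2 hp⟩
    refine lt_of_le_of_ne ((hQ _).1 hyQ i).1 fun heq => ?_
    let g : ℝ → affineSpan ℝ Q := fun t =>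
      ⟨AffineMap.lineMap (y : V) x0 t,
        AffineMap.lineMap_mem t y.2 (subset_affineSpan ℝ Q hx0)⟩
    have hg : Continuous g := by
      apply Continuous.subtype_mk
      exact AffineMap.lineMap_continuous
    have hg0 : g 0 = y := by
      apply Subtype.ext
      simp [g]
    have hn : ∀ᶠ t in nhds (0:ℝ), g t ∈ interior ((↑) ⁻¹' Q : Set (affineSpan ℝ Q)) :=
      hg.continuousAt.eventually_mem (by rw [hg0]; exact isOpen_interior.mem_nhds hy)
    obtain ⟨t, ht, htneg⟩ :=
      ((hn.filter_mono nhdsWithin_le_nhds : ∀ᶠ t in nhdsWithin (0:ℝ) (Set.Iio 0), _).and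
        self_mem_nhdsWithin).exists
    have htQ : (AffineMap.lineMap (y : V) x0 t : V) ∈ Q :=
      interior_subset (s := ((↑) ⁻¹' Q : Set (affineSpan ℝ Q))) ht
    have h1 := ((hQ _).1 htQ i).1
    rw [AffineMap.lineMap_apply] at h1
    simp only [vsub_eq_sub, vadd_eq_add, map_add, map_smul, map_sub, heq, smul_eq_mul] at h1
    have h2 := (h0 i).1 hp
    have : t < 0 := htneg
    nlinarith
  · intro hx
    have hxQ := hst x hx
    refine ⟨⟨x, subset_affineSpan ℝ Q hxQ⟩, ?_, rfl⟩
    rw [mem_interior]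
    refine ⟨{y | ∀ i, ¬ P i → f i (y : V) < c i}, ?_, ?_, fun i => (hx i).1⟩
    · intro y hy
      exact hst _ fun i => ⟨hy i, haff _ y.2 i⟩
    · simp only [Set.ofPred_forall]
      refine isOpen_iInter_of_finite fun i => isOpen_iInter_of_finite fun _ => ?_
      exact isOpen_lt ((hc i).comp continuous_subtype_val) continuous_const

/-- partial sums -/
noncomputable def psum (n k : ℕ) : (↑(Finset.Icc 1 n) → ℝ) →ₗ[ℝ] ℝ :=
  ∑ e : ↑(Finset.Icc 1 n), if (e : ℕ) ≤ k then LinearMap.proj e else 0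

theorem psum_apply (n k : ℕ) (x : ↑(Finset.Icc 1 n) → ℝ) :
    psum n k x = ∑ e : ↑(Finset.Icc 1 n), if (e : ℕ) ≤ k then x e else 0 := by
  simp only [psum, LinearMap.sum_apply]
  refine Finset.sum_congr rfl fun e _ => ?_
  split_ifs <;> simp

/-- extension by zero -/
noncomputable def ext0 (n : ℕ) (x : ↑(Finset.Icc 1 n) → ℝ) (i : ℕ) : ℝ :=
  if h : i ∈ Finset.Icc 1 n then x ⟨i, h⟩ else 0

theorem psum_eq (n k : ℕ) (x : ↑(Finset.Icc 1 n) → ℝ) (hk : k ≤ n) :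
    psum n k x = ∑ i ∈ Finset.range k, ext0 n x (i + 1) := by
  rw [psum_apply]
  have h1 : ∀ e : ↑(Finset.Icc 1 n), (if (e : ℕ) ≤ k then x e else 0)
      = (fun i : ℕ => if i ≤ k then ext0 n x i else 0) e := by
    intro e
    have := e.2
    simp [ext0]
  rw [Finset.sum_congr rfl fun e _ => h1 e]
  rw [Finset.sum_coe_sort (Finset.Icc 1 n) (fun i : ℕ => if i ≤ k then ext0 n x i else 0)]
  rw [← Finset.sum_filter]
  symm
  refine Finset.sum_bij (fun i _ => i + 1) ?_ ?_ ?_ ?_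
  · intro i hi; simp at hi ⊢; omega
  · intro i _ j _ h; omega
  · intro j hj
    simp at hj
    exact ⟨j - 1, by simp; omega, by omega⟩
  · intro i _; rfl

theorem psum_zero (n : ℕ) (x : ↑(Finset.Icc 1 n) → ℝ) : psum n 0 x = 0 := by
  rw [psum_eq n 0 x (Nat.zero_le _)]; simp

theorem psum_succ (n k : ℕ) (x : ↑(Finset.Icc 1 n) → ℝ) (hk : k + 1 ≤ n) :
    psum n (k + 1) x = psum n k x + x ⟨k + 1, by simp; omega⟩ := by
  rw [psum_eq n _ x hk, psum_eq n k x (by omega), Finset.sum_range_succ]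
  congr 1
  unfold ext0
  rw [dif_pos]

/-- vector with prescribed partial sums -/
noncomputable def xOf (n : ℕ) (Y : ℕ → ℝ) : ↑(Finset.Icc 1 n) → ℝ :=
  fun e => Y e - Y ((e : ℕ) - 1)

theorem psum_xOf (n : ℕ) (Y : ℕ → ℝ) (h0 : Y 0 = 0) (k : ℕ) (hk : k ≤ n) :
    psum n k (xOf n Y) = Y k := by
  induction k with
  | zero => rw [psum_zero, h0]
  | succ k ih =>
    rw [psum_succ n k _ hk, ih (by omega)]
    simp [xOf]

theorem eq_of_psum (n : ℕ) (x y : ↑(Finset.Icc 1 n) → ℝ)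
    (h : ∀ k ≤ n, psum n k x = psum n k y) : x = y := by
  funext ⟨e, he⟩
  have he' := Finset.mem_Icc.1 he
  obtain ⟨k, rfl⟩ : ∃ k, e = k + 1 := ⟨e - 1, by omega⟩
  have h1 := psum_succ n k x he'.2
  have h2 := psum_succ n k y he'.2
  have h3 := h k (by omega)
  have h4 := h (k + 1) he'.2
  linarith

/-- number of elements of `B` in `[k]` -/
def cnt (B : Finset ℕ) (k : ℕ) : ℕ := (B ∩ Finset.Icc 1 k).card

theorem cnt_zero (B : Finset ℕ) : cnt B 0 = 0 := by simp [cnt]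

theorem cnt_succ (B : Finset ℕ) (k : ℕ) :
    cnt B (k + 1) = cnt B k + if k + 1 ∈ B then 1 else 0 := by
  unfold cnt
  have : Finset.Icc 1 (k + 1) = insert (k + 1) (Finset.Icc 1 k) := by
    ext i; simp; omega
  rw [this]
  split_ifs with h
  · rw [Finset.inter_insert_of_mem h, Finset.card_insert_of_notMem (by simp)]
  · rw [Finset.inter_insert_of_notMem h, Nat.add_zero]

theorem cnt_eq_card (B : Finset ℕ) (n : ℕ) (h : B ⊆ Finset.Icc 1 n) : cnt B n = B.card := by
  unfold cnt
  rw [Finset.inter_eq_left.2 h]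

theorem psum_basisVector (n : ℕ) (B : Finset ℕ) (k : ℕ) (hk : k ≤ n) :
    psum n k (basisVector (Finset.Icc 1 n) B) = cnt B k := by
  induction k with
  | zero => simp [psum_zero, cnt_zero]
  | succ k ih =>
    rw [psum_succ n k _ hk, ih (by omega), cnt_succ]
    simp [basisVector]

/-- lattice path family -/
noncomputable def Fam (n r : ℕ) (lo hi : ℕ → ℕ) : Finset (Finset ℕ) :=
  (Finset.Icc 1 n).powerset.filter fun B =>
    B.card = r ∧ ∀ k < n, lo k ≤ cnt B k ∧ cnt B k ≤ hi k

theorem mem_Fam {n r : ℕ} {lo hi : ℕ → ℕ} {B : Finset ℕ} :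
    B ∈ Fam n r lo hi ↔ B ⊆ Finset.Icc 1 n ∧ B.card = r ∧
      ∀ k < n, lo k ≤ cnt B k ∧ cnt B k ≤ hi k := by
  simp [Fam]

/-- closed cell -/
def Cell (n r : ℕ) (lo hi : ℕ → ℕ) : Set (↑(Finset.Icc 1 n) → ℝ) :=
  {x | (∀ e, 0 ≤ x e ∧ x e ≤ 1) ∧ psum n n x = r ∧
    ∀ k < n, (lo k : ℝ) ≤ psum n k x ∧ psum n k x ≤ hi k}

/-- open cell -/
def SCell (n r : ℕ) (lo hi : ℕ → ℕ) (x : ↑(Finset.Icc 1 n) → ℝ) : Prop :=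
  (∀ e, 0 < x e ∧ x e < 1) ∧ psum n n x = r ∧
    ∀ k < n, (lo k < hi k → (lo k : ℝ) < psum n k x ∧ psum n k x < hi k) ∧
      (lo k = hi k → psum n k x = lo k)

theorem convex_Cell (n r : ℕ) (lo hi : ℕ → ℕ) : Convex ℝ (Cell n r lo hi) := by
  intro x hx y hy a b ha hb hab
  obtain ⟨hx1, hx2, hx3⟩ := hx
  obtain ⟨hy1, hy2, hy3⟩ := hy
  have key : ∀ l h u v : ℝ, l ≤ u → u ≤ h → l ≤ v → v ≤ h → l ≤ a * u + b * v ∧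
      a * u + b * v ≤ h := by
    intro l h u v h1 h2 h3 h4
    have hb' : b = 1 - a := by linarith
    subst hb'
    constructor <;> nlinarith
  refine ⟨fun e => ?_, ?_, fun k hk => ?_⟩
  · exact key 0 1 _ _ (hx1 e).1 (hx1 e).2 (hy1 e).1 (hy1 e).2
  · rw [map_add, map_smul, map_smul, hx2, hy2, smul_eq_mul, smul_eq_mul, ← add_mul, hab, one_mul]
  · rw [map_add, map_smul, map_smul]
    exact key _ _ _ _ (hx3 k hk).1 (hx3 k hk).2 (hy3 k hk).1 (hy3 k hk).2

theorem continuous_psum (n k : ℕ) : Continuous (psum n k) :=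
  (psum n k).continuous_of_finiteDimensional

theorem isCompact_Cell (n r : ℕ) (lo hi : ℕ → ℕ) : IsCompact (Cell n r lo hi) := by
  have h1 : IsCompact (Set.Icc (0 : ↑(Finset.Icc 1 n) → ℝ) 1) := isCompact_Icc
  refine h1.of_isClosed_subset ?_ ?_
  · unfold Cell
    simp only [Set.ofPred_and, Set.ofPred_forall]
    refine IsClosed.inter ?_ (IsClosed.inter ?_ ?_)
    · refine isClosed_iInter fun e => IsClosed.inter ?_ ?_
      · exact isClosed_le continuous_const (continuous_apply e)
      · exact isClosed_le (continuous_apply e) continuous_const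
    · exact isClosed_eq (continuous_psum n n) continuous_const
    · refine isClosed_iInter fun k => isClosed_iInter fun _ => IsClosed.inter ?_ ?_
      · exact isClosed_le continuous_const (continuous_psum n k)
      · exact isClosed_le (continuous_psum n k) continuous_const
  · intro x hx
    exact ⟨fun e => (hx.1 e).1, fun e => (hx.1 e).2⟩

theorem basisVector_mem_Cell {n r : ℕ} {lo hi : ℕ → ℕ} {B : Finset ℕ}
    (hB : B ∈ Fam n r lo hi) : basisVector (Finset.Icc 1 n) B ∈ Cell n r lo hi := by
  rw [mem_Fam] at hB
  obtain ⟨h1, h2, h3⟩ := hB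
  refine ⟨fun e => ?_, ?_, fun k hk => ?_⟩
  · unfold basisVector; split_ifs <;> simp
  · rw [psum_basisVector n B n le_rfl, cnt_eq_card B n h1, h2]
  · rw [psum_basisVector n B k hk.le]
    exact_mod_cast h3 k hk

theorem extreme_integral {n r : ℕ} {lo hi : ℕ → ℕ} {x : ↑(Finset.Icc 1 n) → ℝ}
    (hx : x ∈ (Cell n r lo hi).extremePoints ℝ) :
    ∀ k ≤ n, ∃ z : ℤ, psum n k x = z := by
  by_contra hcon
  push Not at hcon
  obtain ⟨k0, hk0, hk0'⟩ := hcon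
  let d : ℕ → ℝ := fun k => if ∃ z : ℤ, psum n k x = z then 0 else 1
  have hd0 : d 0 = 0 := by
    simp only [d]; rw [if_pos ⟨0, by simp [psum_zero]⟩]
  have hdn : d n = 0 := by
    simp only [d]; rw [if_pos ⟨r, by rw [hx.1.2.1]; simp⟩]
  have hdk : d k0 = 1 := by
    simp only [d]; rw [if_neg (by push Not; exact hk0')]
  let v := xOf n d
  have hv : ∀ k ≤ n, psum n k v = d k := psum_xOf n d hd0
  have key : ∀ s : ℝ, ∀ᶠ t in nhdsWithin (0:ℝ) (Set.Ioi 0), x + (t * s) • v ∈ Cell n r lo hi := by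
    intro s
    have A : ∀ e : ↑(Finset.Icc 1 n), ∀ᶠ t in nhdsWithin (0:ℝ) (Set.Ioi 0),
        0 ≤ (x + (t * s) • v) e ∧ (x + (t * s) • v) e ≤ 1 := by
      rintro ⟨e, he⟩
      have he' := Finset.mem_Icc.1 he
      obtain ⟨k, rfl⟩ : ∃ k, e = k + 1 := ⟨e - 1, by omega⟩
      have hxe := hx.1.1 ⟨k + 1, he⟩
      have hps := psum_succ n k x he'.2
      have hve : v ⟨k + 1, he⟩ = d (k + 1) - d k := by simp [v, xOf]
      simp only [Pi.add_apply, Pi.smul_apply, smul_eq_mul, hve]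
      by_cases hInt : ∃ z : ℤ, x ⟨k + 1, he⟩ = z
      · obtain ⟨z, hz⟩ := hInt
        have hdd : d (k + 1) = d k := by
          simp only [d]
          congr 1
          rw [hps, hz]
          apply propext
          constructor
          · rintro ⟨w, hw⟩; exact ⟨w - z, by push_cast; linarith⟩
          · rintro ⟨w, hw⟩; exact ⟨w + z, by push_cast; linarith⟩
        refine Filter.Eventually.of_forall fun t => ?_
        simpa [hdd] using hxe
      · push Not at hInt
        have h1 : 0 < x ⟨k + 1, he⟩ := lt_of_le_of_ne hxe.1 fun h => hInt 0 (by simp [← h])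
        have h2 : x ⟨k + 1, he⟩ < 1 := lt_of_le_of_ne hxe.2 fun h => hInt 1 (by simp [h])
        have hcont : Continuous fun t : ℝ => x ⟨k + 1, he⟩ + t * s * (d (k + 1) - d k) := by
          fun_prop
        have h3 := hcont.continuousAt.eventually_mem (x := 0)
          ((isOpen_Ioo (a := (0:ℝ)) (b := 1)).mem_nhds (by simpa using ⟨h1, h2⟩))
        filter_upwards [h3.filter_mono nhdsWithin_le_nhds] with t ht
        exact ⟨ht.1.le, ht.2.le⟩
    have C : ∀ k : Fin n, ∀ᶠ t in nhdsWithin (0:ℝ) (Set.Ioi 0),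
        (lo k : ℝ) ≤ psum n k (x + (t * s) • v) ∧ psum n k (x + (t * s) • v) ≤ hi k := by
      rintro ⟨k, hk⟩
      have hxk := hx.1.2.2 k hk
      simp only [map_add, map_smul, smul_eq_mul, hv k hk.le]
      by_cases hInt : ∃ z : ℤ, psum n k x = z
      · have hdd : d k = 0 := by simp only [d]; rw [if_pos hInt]
        refine Filter.Eventually.of_forall fun t => ?_
        simpa [hdd] using hxk
      · push Not at hInt
        have h1 : (lo k : ℝ) < psum n k x :=
          lt_of_le_of_ne hxk.1 fun h => hInt (lo k) (by simp [← h])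
        have h2 : psum n k x < hi k := lt_of_le_of_ne hxk.2 fun h => hInt (hi k) (by simp [h])
        have hcont : Continuous fun t : ℝ => psum n k x + t * s * d k := by
          fun_prop
        have h3 := hcont.continuousAt.eventually_mem (x := 0)
          ((isOpen_Ioo (a := (lo k:ℝ)) (b := (hi k:ℝ))).mem_nhds (by simpa using ⟨h1, h2⟩))
        filter_upwards [h3.filter_mono nhdsWithin_le_nhds] with t ht
        exact ⟨ht.1.le, ht.2.le⟩
    filter_upwards [Filter.eventually_all.2 A, Filter.eventually_all.2 C] with t hA hC
    refine ⟨hA, ?_, fun k hk => hC ⟨k, hk⟩⟩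
    rw [map_add, map_smul, hv n le_rfl, hdn, hx.1.2.1]
    simp
  obtain ⟨t, ⟨h1, h2⟩, ht⟩ := (((key 1).and (key (-1))).and self_mem_nhdsWithin).exists
  have htpos : 0 < t := ht
  have hseg : x ∈ openSegment ℝ (x + (t * 1) • v) (x + (t * -1) • v) := by
    refine ⟨1/2, 1/2, by norm_num, by norm_num, by norm_num, ?_⟩
    ext e
    simp
    ring
  have := hx.2 h1 h2 hseg
  have h3 : psum n k0 (x + (t * 1) • v) = psum n k0 x := by rw [this]
  rw [map_add, map_smul, hv k0 hk0, hdk] at h3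
  simp at h3
  exact htpos.ne' h3

theorem hull_eq (n r : ℕ) (lo hi : ℕ → ℕ) :
    basePolytope (Finset.Icc 1 n) (Fam n r lo hi) = Cell n r lo hi := by
  apply Set.Subset.antisymm
  · refine convexHull_min ?_ (convex_Cell n r lo hi)
    rintro _ ⟨B, hB, rfl⟩
    exact basisVector_mem_Cell hB
  · rw [← closure_convexHull_extremePoints (isCompact_Cell n r lo hi) (convex_Cell n r lo hi)]
    have hfin : (basisVector (Finset.Icc 1 n) '' (↑(Fam n r lo hi) : Set (Finset ℕ))).Finite :=
      (Finset.finite_toSet _).image _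
    have hcl : IsClosed (basePolytope (Finset.Icc 1 n) (Fam n r lo hi)) :=
      hfin.isClosed_convexHull ℝ
    refine closure_minimal (convexHull_mono ?_) hcl
    intro x hx
    have hInt := extreme_integral hx
    obtain ⟨⟨hx1, hx2, hx3⟩, -⟩ := hx
    have h01 : ∀ e, x e = 0 ∨ x e = 1 := by
      rintro ⟨e, he⟩
      have he' := Finset.mem_Icc.1 he
      obtain ⟨k, rfl⟩ : ∃ k, e = k + 1 := ⟨e - 1, by omega⟩
      have hps := psum_succ n k x he'.2
      obtain ⟨a, ha⟩ := hInt k (by omega)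
      obtain ⟨b, hb⟩ := hInt (k + 1) he'.2
      have hxe := hx1 ⟨k + 1, he⟩
      have hab : x ⟨k + 1, he⟩ = ((b - a : ℤ) : ℝ) := by push_cast; linarith
      rw [hab] at hxe ⊢
      have h1 : 0 ≤ b - a := by exact_mod_cast hxe.1
      have h2 : b - a ≤ 1 := by exact_mod_cast hxe.2
      have : b - a = 0 ∨ b - a = 1 := by omega
      rcases this with h | h <;> simp [h]
    let B : Finset ℕ := (Finset.Icc 1 n).filter fun i => ext0 n x i = 1
    have hBx : basisVector (Finset.Icc 1 n) B = x := by
      funext ⟨e, he⟩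
      have := h01 ⟨e, he⟩
      have hBe : e ∈ B ↔ x ⟨e, he⟩ = 1 := by
        have hxe : ext0 n x e = x ⟨e, he⟩ := dif_pos he
        rw [← hxe]
        exact ⟨fun h => (Finset.mem_filter.1 h).2, fun h => Finset.mem_filter.2 ⟨he, h⟩⟩
      simp only [basisVector, hBe]
      rcases this with h | h <;> simp [h]
    have hBsub : B ⊆ Finset.Icc 1 n := Finset.filter_subset _ _
    refine ⟨B, ?_, hBx⟩
    rw [Finset.mem_coe, mem_Fam]
    refine ⟨hBsub, ?_, fun k hk => ?_⟩
    · have := psum_basisVector n B n le_rfl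
      rw [hBx, hx2, cnt_eq_card B n hBsub] at this
      exact_mod_cast this.symm
    · have h1 := psum_basisVector n B k hk.le
      have h2 := hx3 k hk
      rw [hBx] at h1
      rw [h1] at h2
      exact_mod_cast h2

theorem relint_Fam (n r : ℕ) (lo hi : ℕ → ℕ) (hlh : ∀ k < n, lo k ≤ hi k)
    (x0 : ↑(Finset.Icc 1 n) → ℝ) (h0 : SCell n r lo hi x0) (x : ↑(Finset.Icc 1 n) → ℝ) :
    x ∈ intrinsicInterior ℝ (basePolytope (Finset.Icc 1 n) (Fam n r lo hi)) ↔
      SCell n r lo hi x := by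
  rw [hull_eq]
  let E := ↑(Finset.Icc 1 n)
  let f : (E ⊕ E) ⊕ (Fin n ⊕ Fin n) ⊕ Unit → (E → ℝ) →ₗ[ℝ] ℝ :=
    Sum.elim (Sum.elim (fun e => - LinearMap.proj e) (fun e => LinearMap.proj e))
      (Sum.elim (Sum.elim (fun k => - psum n k) (fun k => psum n k)) (fun _ => psum n n))
  let c : (E ⊕ E) ⊕ (Fin n ⊕ Fin n) ⊕ Unit → ℝ :=
    Sum.elim (Sum.elim (fun e => 0) (fun e => 1))
      (Sum.elim (Sum.elim (fun k => - (lo k : ℝ)) (fun k => (hi k : ℝ))) (fun _ => r))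
  let P : (E ⊕ E) ⊕ (Fin n ⊕ Fin n) ⊕ Unit → Prop :=
    Sum.elim (Sum.elim (fun e => False) (fun e => False))
      (Sum.elim (Sum.elim (fun k => lo k = hi k) (fun k => lo k = hi k)) (fun _ => True))
  have hS : ∀ y, SCell n r lo hi y ↔ ∀ i, (¬ P i → f i y < c i) ∧ (P i → f i y = c i) := by
    intro y
    simp only [Sum.forall, f, c, P, Sum.elim_inl, Sum.elim_inr, SCell]
    constructor
    · rintro ⟨h1, h2, h3⟩
      refine ⟨⟨fun e => ?_, fun e => ?_⟩, ⟨fun k => ?_, fun k => ?_⟩, fun _ => ?_⟩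
      · simpa using (h1 e).1
      · simpa using (h1 e).2
      · have := h3 k k.2
        have hl := hlh k k.2
        refine ⟨fun hne => ?_, fun he => ?_⟩
        · simpa using (this.1 (lt_of_le_of_ne hl hne)).1
        · simpa using this.2 he
      · have := h3 k k.2
        have hl := hlh k k.2
        refine ⟨fun hne => ?_, fun he => ?_⟩
        · simpa using (this.1 (lt_of_le_of_ne hl hne)).2
        · simpa [← he] using this.2 he
      · simpa using h2
    · rintro ⟨⟨h1, h2⟩, ⟨h3, h4⟩, h5⟩
      refine ⟨fun e => ⟨?_, ?_⟩, by simpa using h5, fun k hk => ⟨fun hlt => ⟨?_, ?_⟩, fun he => ?_⟩⟩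
      · simpa using (h1 e)
      · simpa using (h2 e)
      · simpa using (h3 ⟨k, hk⟩).1 hlt.ne
      · simpa using (h4 ⟨k, hk⟩).1 hlt.ne
      · simpa using (h3 ⟨k, hk⟩).2 he
  have hQ : ∀ y, y ∈ Cell n r lo hi ↔ ∀ i, f i y ≤ c i ∧ (P i → f i y = c i) := by
    intro y
    simp only [Sum.forall, f, c, P, Sum.elim_inl, Sum.elim_inr, Cell, Set.mem_ofPred_eq]
    constructor
    · rintro ⟨h1, h2, h3⟩
      refine ⟨⟨fun e => ?_, fun e => ?_⟩, ⟨fun k => ?_, fun k => ?_⟩, fun _ => ?_⟩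
      · simpa using (h1 e).1
      · simpa using (h1 e).2
      · have := h3 k k.2
        refine ⟨by simpa using this.1, fun he => ?_⟩
        rw [← he] at this
        simpa using le_antisymm this.2 this.1
      · have := h3 k k.2
        refine ⟨by simpa using this.2, fun he => ?_⟩
        rw [he] at this
        simpa using le_antisymm this.2 this.1
      · simpa using ⟨h2.le, h2⟩
    · rintro ⟨⟨h1, h2⟩, ⟨h3, h4⟩, h5⟩
      refine ⟨fun e => ⟨?_, ?_⟩, by simpa using (h5 ()).2, fun k hk => ⟨?_, ?_⟩⟩
      · simpa using (h1 e)
      · simpa using (h2 e)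
      · simpa using (h3 ⟨k, hk⟩).1
      · simpa using (h4 ⟨k, hk⟩).1
  rw [hS]
  exact relint_gen f c P (Cell n r lo hi) hQ x0 ((hS x0).1 h0) x

/-! ### Basis exchange for lattice path families -/

theorem mem_iff_cnt (B : Finset ℕ) (k : ℕ) : k + 1 ∈ B ↔ cnt B (k + 1) = cnt B k + 1 := by
  rw [cnt_succ]; split_ifs with h <;> simp [h]

theorem cnt_mono (B : Finset ℕ) {j k : ℕ} (h : j ≤ k) : cnt B j ≤ cnt B k := by
  unfold cnt
  apply Finset.card_le_card
  intro i
  simp only [Finset.mem_inter, Finset.mem_Icc]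
  rintro ⟨h1, h2, h3⟩
  exact ⟨h1, h2, h3.trans h⟩

theorem cnt_eq_sum (B : Finset ℕ) (k : ℕ) :
    cnt B k = ∑ i ∈ Finset.Icc 1 k, if i ∈ B then 1 else 0 := by
  unfold cnt
  rw [Finset.inter_comm, ← Finset.filter_mem_eq_inter, Finset.card_filter]

theorem cnt_insert (B : Finset ℕ) {y : ℕ} (k : ℕ) (hy : y ∉ B) (h1 : 1 ≤ y) :
    cnt (insert y B) k = cnt B k + if y ≤ k then 1 else 0 := by
  unfold cnt
  split_ifs with h
  · rw [Finset.insert_inter_of_mem (by simp; omega), Finset.card_insert_of_notMem (by simp [hy])]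
  · rw [Finset.insert_inter_of_notMem (by simp; omega), Nat.add_zero]

theorem cnt_erase (B : Finset ℕ) {x : ℕ} (k : ℕ) (hx : x ∈ B) (h1 : 1 ≤ x) :
    cnt (B.erase x) k + (if x ≤ k then 1 else 0) = cnt B k := by
  have := cnt_insert (B.erase x) k (Finset.notMem_erase x B) h1
  rw [Finset.insert_erase hx] at this
  exact this.symm

theorem cnt_swap (B : Finset ℕ) {x y : ℕ} (k : ℕ) (hx : x ∈ B) (hy : y ∉ B) (h1 : 1 ≤ x)
    (h2 : 1 ≤ y) :
    cnt (insert y (B.erase x)) k + (if x ≤ k then 1 else 0)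
      = cnt B k + if y ≤ k then 1 else 0 := by
  rw [cnt_insert (B.erase x) k (by simp [hy]) h2, ← cnt_erase B k hx h1]
  omega

theorem card_swap (B : Finset ℕ) {x y : ℕ} (hx : x ∈ B) (hy : y ∉ B) :
    (insert y (B.erase x)).card = B.card := by
  rw [Finset.card_insert_of_notMem (by simp [hy]), Finset.card_erase_add_one hx]

theorem isBasisFamily_Fam (n r : ℕ) (lo hi : ℕ → ℕ) (hne : (Fam n r lo hi).Nonempty) :
    IsBasisFamily (Finset.Icc 1 n) (Fam n r lo hi) := by
  refine ⟨hne, fun B hB => (mem_Fam.1 hB).1, ?_⟩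
  intro B₁ hB₁ B₂ hB₂ x hx
  obtain ⟨s1, c1, b1⟩ := mem_Fam.1 hB₁
  obtain ⟨s2, c2, b2⟩ := mem_Fam.1 hB₂
  obtain ⟨hx1, hx2⟩ := Finset.mem_sdiff.1 hx
  have hxr := Finset.mem_Icc.1 (s1 hx1)
  have e1 : cnt B₁ n = r := by rw [cnt_eq_card B₁ n s1, c1]
  have e2 : cnt B₂ n = r := by rw [cnt_eq_card B₂ n s2, c2]
  obtain ⟨z, rfl⟩ : ∃ z, x = z + 1 := ⟨x - 1, by omega⟩
  have hs1 := cnt_succ B₁ z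
  have hs2 := cnt_succ B₂ z
  rw [if_pos hx1] at hs1
  rw [if_neg hx2] at hs2
  by_cases hd : cnt B₂ (z + 1) < cnt B₁ (z + 1)
  · -- move forward
    have hex : ∃ y, z + 1 < y ∧ cnt B₁ y ≤ cnt B₂ y := by
      refine ⟨n, lt_of_le_of_ne hxr.2 ?_, by omega⟩
      rintro h
      rw [h] at hd
      omega
    have hy := Nat.find_spec hex
    have hymin := fun m (h : m < Nat.find hex) => Nat.find_min hex h
    set y := Nat.find hex with hydef
    clear_value y
    obtain ⟨w, rfl⟩ : ∃ w, y = w + 1 := ⟨y - 1, by omega⟩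
    have hlt : ∀ k, z + 1 ≤ k → k < w + 1 → cnt B₂ k < cnt B₁ k := by
      intro k h1 h2
      rcases Nat.eq_or_lt_of_le h1 with h | h
      · rw [← h]; exact hd
      · have := hymin k h2
        push Not at this
        exact this h
    have hw := hlt w (by omega) (by omega)
    have t1 := cnt_succ B₁ w
    have t2 := cnt_succ B₂ w
    have hyB1 : w + 1 ∉ B₁ := by
      intro h; rw [if_pos h] at t1
      split_ifs at t2 <;> omega
    have hyB2 : w + 1 ∈ B₂ := by
      by_contra h; rw [if_neg h] at t2
      split_ifs at t1 <;> omega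
    refine ⟨w + 1, Finset.mem_sdiff.2 ⟨hyB2, hyB1⟩, mem_Fam.2 ⟨?_, ?_, ?_⟩⟩
    · intro i hi
      rcases Finset.mem_insert.1 hi with h | h
      · rw [h]; exact s2 hyB2
      · exact s1 (Finset.mem_of_mem_erase h)
    · rw [card_swap B₁ hx1 hyB1, c1]
    · intro k hk
      have hc := cnt_swap B₁ k hx1 hyB1 (by omega) (by omega)
      have hb1 := b1 k hk
      have hb2 := b2 k hk
      by_cases h1 : z + 1 ≤ k
      · by_cases h2 : w + 1 ≤ k
        · rw [if_pos h1, if_pos h2] at hc; omega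
        · rw [if_pos h1, if_neg h2] at hc
          have := hlt k h1 (by omega)
          omega
      · rw [if_neg h1, if_neg (by omega)] at hc; omega
  · -- move backward
    have hd' : cnt B₁ z < cnt B₂ z := by omega
    let p : ℕ → Prop := fun y => cnt B₂ y ≤ cnt B₁ y
    have h0 : p 0 := by simp [p, cnt_zero]
    have hy := Nat.findGreatest_spec (P := p) (Nat.zero_le z) h0
    have hymax := fun k (h : Nat.findGreatest p z < k) (h' : k ≤ z) =>
      Nat.findGreatest_is_greatest h h'
    have hyle := Nat.findGreatest_le (P := p) z
    set w := Nat.findGreatest p z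
    clear_value w
    have hwz : w < z := by
      refine lt_of_le_of_ne hyle ?_
      rintro rfl
      simp only [p] at hy
      omega
    have hlt : ∀ k, w + 1 ≤ k → k < z + 1 → cnt B₁ k < cnt B₂ k := by
      intro k h1 h2
      have := hymax k (by omega) (by omega)
      simp only [p] at this
      omega
    have hw := hlt (w + 1) (by omega) (by omega)
    simp only [p] at hy
    have t1 := cnt_succ B₁ w
    have t2 := cnt_succ B₂ w
    have hyB1 : w + 1 ∉ B₁ := by
      intro h; rw [if_pos h] at t1
      split_ifs at t2 <;> omega
    have hyB2 : w + 1 ∈ B₂ := by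
      by_contra h; rw [if_neg h] at t2
      split_ifs at t1 <;> omega
    refine ⟨w + 1, Finset.mem_sdiff.2 ⟨hyB2, hyB1⟩, mem_Fam.2 ⟨?_, ?_, ?_⟩⟩
    · intro i hi
      rcases Finset.mem_insert.1 hi with h | h
      · rw [h]; exact s2 hyB2
      · exact s1 (Finset.mem_of_mem_erase h)
    · rw [card_swap B₁ hx1 hyB1, c1]
    · intro k hk
      have hc := cnt_swap B₁ k hx1 hyB1 (by omega) (by omega)
      have hb1 := b1 k hk
      have hb2 := b2 k hk
      by_cases h1 : z + 1 ≤ k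
      · rw [if_pos h1, if_pos (by omega)] at hc; omega
      · by_cases h2 : w + 1 ≤ k
        · rw [if_neg h1, if_pos h2] at hc
          have := hlt k h2 (by omega)
          omega
        · rw [if_neg h1, if_neg h2] at hc; omega

/-! ### Gale order -/

theorem forall2_count {l1 l2 : List ℕ} (h : List.Forall₂ (· ≤ ·) l1 l2) (k : ℕ) :
    l2.countP (· ≤ k) ≤ l1.countP (· ≤ k) := by
  induction h with
  | nil => simp
  | cons hab _ ih =>
    simp only [List.countP_cons, decide_eq_true_eq]
    split_ifs <;> omega

theorem count_forall2 : ∀ (l1 l2 : List ℕ), l1.Pairwise (· ≤ ·) → l2.Pairwise (· ≤ ·) →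
    l1.length = l2.length → (∀ k, l2.countP (· ≤ k) ≤ l1.countP (· ≤ k)) →
    List.Forall₂ (· ≤ ·) l1 l2
  | [], [], _, _, _, _ => List.Forall₂.nil
  | a :: l1, b :: l2, h1, h2, hlen, hc => by
    rw [List.pairwise_cons] at h1 h2
    have hab : a ≤ b := by
      have := hc b
      have hpos : 0 < (a :: l1).countP (· ≤ b) := by
        refine lt_of_lt_of_le ?_ this
        rw [List.countP_pos_iff]
        exact ⟨b, by simp, by simp⟩
      rw [List.countP_pos_iff] at hpos
      obtain ⟨c, hc1, hc2⟩ := hpos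
      simp only [decide_eq_true_eq] at hc2
      rcases List.mem_cons.1 hc1 with h | h
      · omega
      · exact (h1.1 c h).trans hc2
    refine List.Forall₂.cons hab (count_forall2 l1 l2 h1.2 h2.2 (by simpa using hlen) ?_)
    intro k
    by_cases hk : b ≤ k
    · have := hc k
      simp only [List.countP_cons, decide_eq_true_eq] at this
      rw [if_pos hk, if_pos (hab.trans hk)] at this
      omega
    · have : l2.countP (· ≤ k) = 0 := by
        rw [List.countP_eq_zero]
        intro c hc
        have := h2.1 c hc
        simp only [decide_eq_true_eq]
        omega
      omega

theorem countP_sort (B : Finset ℕ) (n k : ℕ) (hB : B ⊆ Finset.Icc 1 n) :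
    (B.sort (· ≤ ·)).countP (· ≤ k) = cnt B k := by
  rw [← Multiset.coe_countP, Finset.sort_eq, Multiset.countP_eq_card_filter]
  unfold cnt
  have : B ∩ Finset.Icc 1 k = B.filter (· ≤ k) := by
    ext i
    simp only [Finset.mem_inter, Finset.mem_Icc, Finset.mem_filter]
    constructor
    · rintro ⟨h1, h2⟩; exact ⟨h1, h2.2⟩
    · rintro ⟨h1, h2⟩; exact ⟨h1, (Finset.mem_Icc.1 (hB h1)).1, h2⟩
  rw [this]
  rfl

theorem galeLe_iff (n : ℕ) (U B : Finset ℕ) (hU : U ⊆ Finset.Icc 1 n) (hB : B ⊆ Finset.Icc 1 n)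
    (hc : U.card = B.card) : galeLe U B ↔ ∀ k, cnt B k ≤ cnt U k := by
  unfold galeLe
  constructor
  · intro h k
    rw [← countP_sort B n k hB, ← countP_sort U n k hU]
    exact forall2_count h k
  · intro h
    refine count_forall2 _ _ (Finset.pairwise_sort _ _) (Finset.pairwise_sort _ _) (by simpa) ?_
    intro k
    rw [countP_sort B n k hB, countP_sort U n k hU]
    exact h k

theorem schubert_eq_Fam (n r : ℕ) (U : Finset ℕ) (hU : U ⊆ Finset.Icc 1 n) (hr : U.card = r) :
    schubertBases n r U = Fam n r (fun _ => 0) (cnt U) := by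
  ext B
  rw [mem_Fam, schubertBases, Finset.mem_filter, Finset.mem_powerset]
  constructor
  · rintro ⟨h1, h2, h3⟩
    refine ⟨h1, h2, fun k _ => ⟨Nat.zero_le _, ?_⟩⟩
    exact (galeLe_iff n U B hU h1 (hr.trans h2.symm)).1 h3 k
  · rintro ⟨h1, h2, h3⟩
    refine ⟨h1, h2, (galeLe_iff n U B hU h1 (hr.trans h2.symm)).2 fun k => ?_⟩
    rcases lt_or_ge k n with hk | hk
    · exact (h3 k hk).2
    · rw [cnt_eq_card B k (h1.trans (Finset.Icc_subset_Icc_right hk)),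
        cnt_eq_card U k (hU.trans (Finset.Icc_subset_Icc_right hk)), hr, h2]

/-! ### Parallel and series extensions, direct sums -/

/-- parallel extension of `p` by the new element `q` -/
noncomputable def parExt (F : Finset (Finset ℕ)) (p q : ℕ) : Finset (Finset ℕ) :=
  F ∪ (F.filter (p ∈ ·)).image fun B => insert q (B.erase p)

/-- series extension of `p` by the new element `q` -/
noncomputable def serExt (F : Finset (Finset ℕ)) (p q : ℕ) : Finset (Finset ℕ) :=
  F.image (insert q) ∪ (F.filter (p ∉ ·)).image (insert p)

theorem mem_parExt {F : Finset (Finset ℕ)} {p q : ℕ} {B : Finset ℕ} :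
    B ∈ parExt F p q ↔ B ∈ F ∨ ∃ B' ∈ F, p ∈ B' ∧ insert q (B'.erase p) = B := by
  simp [parExt, and_assoc]

theorem mem_serExt {F : Finset (Finset ℕ)} {p q : ℕ} {B : Finset ℕ} :
    B ∈ serExt F p q ↔ (∃ B' ∈ F, insert q B' = B) ∨ ∃ B' ∈ F, p ∉ B' ∧ insert p B' = B := by
  simp [serExt, and_assoc]

theorem le_famRank {F : Finset (Finset ℕ)} {B : Finset ℕ} (hB : B ∈ F) (A : Finset ℕ) :
    (A ∩ B).card ≤ famRank F A :=
  Finset.le_sup (f := fun B => (A ∩ B).card) hB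

theorem famRank_le {F : Finset (Finset ℕ)} {A : Finset ℕ} {m : ℕ}
    (h : ∀ B ∈ F, (A ∩ B).card ≤ m) : famRank F A ≤ m :=
  Finset.sup_le h

theorem famRank_eq_card {F : Finset (Finset ℕ)} {E : Finset ℕ} {s : ℕ} (hne : F.Nonempty)
    (h : ∀ B ∈ F, B ⊆ E ∧ B.card = s) : famRank F E = s := by
  apply le_antisymm
  · refine famRank_le fun B hB => ?_
    rw [Finset.inter_eq_right.2 (h B hB).1, (h B hB).2]
  · obtain ⟨B, hB⟩ := hne
    have := le_famRank hB E
    rwa [Finset.inter_eq_right.2 (h B hB).1, (h B hB).2] at this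

theorem eqvGen_mono' {R S : ℕ → ℕ → Prop} (h : ∀ a b, R a b → S a b) {e f : ℕ}
    (hef : Relation.EqvGen R e f) : Relation.EqvGen S e f := by
  induction hef with
  | rel a b hab => exact Relation.EqvGen.rel _ _ (h a b hab)
  | refl a => exact Relation.EqvGen.refl a
  | symm a b _ ih => exact ih.symm _ _
  | trans a b c _ _ ih1 ih2 => exact ih1.trans _ _ _ ih2

section ext
variable {F : Finset (Finset ℕ)} {E : Finset ℕ} {p q : ℕ}

theorem rank_par_old (hF : ∀ B ∈ F, B ⊆ E) (hq : q ∉ E) {A : Finset ℕ} (hA : A ⊆ E) :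
    famRank (parExt F p q) A = famRank F A := by
  apply le_antisymm
  · refine famRank_le fun B hB => ?_
    rcases mem_parExt.1 hB with h | ⟨B', h, hp, rfl⟩
    · exact le_famRank h A
    · refine le_trans (Finset.card_le_card ?_) (le_famRank h A)
      intro i
      simp only [Finset.mem_inter, Finset.mem_insert, Finset.mem_erase]
      rintro ⟨h1, h2 | h2⟩
      · subst h2; exact absurd (hA h1) hq
      · exact ⟨h1, h2.2⟩
  · exact famRank_le fun B hB => le_famRank (mem_parExt.2 (Or.inl hB)) A

theorem rank_par_new (hF : ∀ B ∈ F, B ⊆ E) (hq : q ∉ E) (hp : p ∈ E) {A : Finset ℕ}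
    (hA : A ⊆ E) (hpA : p ∉ A) :
    famRank (parExt F p q) (insert q A) = famRank F (insert p A) := by
  have hpq : p ≠ q := by rintro rfl; exact hq hp
  apply le_antisymm
  · refine famRank_le fun B hB => ?_
    rcases mem_parExt.1 hB with h | ⟨B', h, hp, rfl⟩
    · refine le_trans (Finset.card_le_card ?_) (le_famRank h _)
      intro i
      simp only [Finset.mem_inter, Finset.mem_insert]
      rintro ⟨h1 | h1, h2⟩
      · subst h1; exact absurd (hF B h h2) hq
      · exact ⟨Or.inr h1, h2⟩
    · refine le_trans (le_of_eq ?_) (le_famRank h _)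
      rw [Finset.insert_inter_of_mem (by simp), Finset.insert_inter_of_mem hp,
        Finset.card_insert_of_notMem (fun hh => hq (hA (Finset.mem_of_mem_inter_left hh))),
        Finset.card_insert_of_notMem (by simp [hpA])]
      congr 2
      ext i
      simp only [Finset.mem_inter, Finset.mem_insert, Finset.mem_erase]
      constructor
      · rintro ⟨h1, h2 | h2⟩
        · subst h2; exact absurd (hA h1) hq
        · exact ⟨h1, h2.2⟩
      · rintro ⟨h1, h2⟩
        exact ⟨h1, Or.inr ⟨by rintro rfl; exact hpA h1, h2⟩⟩
  · refine famRank_le fun B hB => ?_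
    by_cases hpB : p ∈ B
    · refine le_trans (le_of_eq ?_)
        (le_famRank (mem_parExt.2 (Or.inr ⟨B, hB, hpB, rfl⟩)) (insert q A))
      symm
      rw [Finset.insert_inter_of_mem (by simp), Finset.insert_inter_of_mem hpB,
        Finset.card_insert_of_notMem (fun hh => hq (hA (Finset.mem_of_mem_inter_left hh))),
        Finset.card_insert_of_notMem (by simp [hpA])]
      congr 2
      ext i
      simp only [Finset.mem_inter, Finset.mem_insert, Finset.mem_erase]
      constructor
      · rintro ⟨h1, h2 | h2⟩
        · subst h2; exact absurd (hA h1) hq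
        · exact ⟨h1, h2.2⟩
      · rintro ⟨h1, h2⟩
        exact ⟨h1, Or.inr ⟨by rintro rfl; exact hpA h1, h2⟩⟩
    · refine le_trans (Finset.card_le_card ?_)
        (le_famRank (mem_parExt.2 (Or.inl hB)) (insert q A))
      intro i
      simp only [Finset.mem_inter, Finset.mem_insert]
      rintro ⟨h1 | h1, h2⟩
      · subst h1; exact absurd h2 hpB
      · exact ⟨Or.inr h1, h2⟩

theorem rank_par_both (hF : ∀ B ∈ F, B ⊆ E) (hq : q ∉ E) (hp : p ∈ E) {A : Finset ℕ}
    (hA : A ⊆ E) (hpA : p ∉ A) :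
    famRank (parExt F p q) (insert q (insert p A)) = famRank F (insert p A) := by
  have hpq : p ≠ q := by rintro rfl; exact hq hp
  apply le_antisymm
  · refine famRank_le fun B hB => ?_
    rcases mem_parExt.1 hB with h | ⟨B', h, hp, rfl⟩
    · refine le_trans (Finset.card_le_card ?_) (le_famRank h _)
      intro i
      simp only [Finset.mem_inter, Finset.mem_insert]
      rintro ⟨h1 | h1, h2⟩
      · subst h1; exact absurd (hF B h h2) hq
      · exact ⟨h1, h2⟩
    · refine le_trans (le_of_eq ?_) (le_famRank h _)
      have : insert q (insert p A) ∩ insert q (B'.erase p) = insert q (A ∩ B') := by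
        ext i
        simp only [Finset.mem_inter, Finset.mem_insert, Finset.mem_erase]
        constructor
        · rintro ⟨h1 | h1 | h1, h2 | h2⟩ <;> tauto
        · rintro (h1 | ⟨h1, h2⟩)
          · tauto
          · have : i ≠ p := by rintro rfl; exact hpA h1
            tauto
      rw [this, Finset.insert_inter_of_mem hp,
        Finset.card_insert_of_notMem (fun hh => hq (hA (Finset.mem_of_mem_inter_left hh))),
        Finset.card_insert_of_notMem (by simp [hpA])]
  · refine famRank_le fun B hB => ?_
    refine le_trans (Finset.card_le_card ?_)
        (le_famRank (mem_parExt.2 (Or.inl hB)) (insert q (insert p A)))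
    exact Finset.inter_subset_inter_right (Finset.subset_insert _ _)

theorem rank_ser_none (hF : ∀ B ∈ F, B ⊆ E) (hq : q ∉ E) {A : Finset ℕ}
    (hA : A ⊆ E) (hpA : p ∉ A) : famRank (serExt F p q) A = famRank F A := by
  have hqA : q ∉ A := fun h => hq (hA h)
  apply le_antisymm
  · refine famRank_le fun B hB => ?_
    rcases mem_serExt.1 hB with ⟨B', h, rfl⟩ | ⟨B', h, hp, rfl⟩
    · rw [Finset.inter_insert_of_notMem hqA]; exact le_famRank h A
    · rw [Finset.inter_insert_of_notMem hpA]; exact le_famRank h A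
  · refine famRank_le fun B hB => ?_
    have := le_famRank (mem_serExt (p := p) (q := q).2 (Or.inl ⟨B, hB, rfl⟩)) A
    rwa [Finset.inter_insert_of_notMem hqA] at this

theorem rank_ser_q (hF : ∀ B ∈ F, B ⊆ E) (hne : F.Nonempty) (hq : q ∉ E) (hp : p ∈ E)
    {A : Finset ℕ} (hA : A ⊆ E) (hpA : p ∉ A) :
    famRank (serExt F p q) (insert q A) = famRank F A + 1 := by
  have hqA : q ∉ A := fun h => hq (hA h)
  have hpq : p ≠ q := by rintro rfl; exact hq hp
  have key : ∀ B, (insert q A ∩ insert q B).card = (A ∩ B).card + 1 := by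
    intro B
    rw [← Finset.insert_inter_distrib, Finset.card_insert_of_notMem (by simp [hqA])]
  apply le_antisymm
  · refine famRank_le fun B hB => ?_
    rcases mem_serExt.1 hB with ⟨B', h, rfl⟩ | ⟨B', h, hp, rfl⟩
    · rw [key]; have := le_famRank h A; omega
    · rw [Finset.inter_insert_of_notMem (by simp [hpA, hpq]),
        Finset.insert_inter_of_notMem (fun hh => hq (hF _ h hh))]
      have := le_famRank h A; omega
  · obtain ⟨B, hB, hBr⟩ := Finset.exists_mem_eq_sup F hne (fun B => (A ∩ B).card)
    have := le_famRank (mem_serExt (p := p) (q := q).2 (Or.inl ⟨B, hB, rfl⟩)) (insert q A)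
    rw [key] at this
    unfold famRank at this ⊢
    omega

theorem rank_ser_p (hF : ∀ B ∈ F, B ⊆ E) (hne : F.Nonempty) (hq : q ∉ E) (hp : p ∈ E)
    {A : Finset ℕ} (hA : A ⊆ E) (hpA : p ∉ A) :
    famRank (serExt F p q) (insert p A) = famRank F A + 1 := by
  have hqA : q ∉ A := fun h => hq (hA h)
  have hpq : p ≠ q := by rintro rfl; exact hq hp
  have key : ∀ B, (insert p A ∩ insert p B).card = (A ∩ B).card + 1 := by
    intro B
    rw [← Finset.insert_inter_distrib, Finset.card_insert_of_notMem (by simp [hpA])]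
  have hle : ∀ B ∈ F, (insert p A ∩ B).card ≤ (A ∩ B).card + 1 := by
    intro B _
    rw [← key]
    exact Finset.card_le_card (Finset.inter_subset_inter_left (Finset.subset_insert _ _))
  apply le_antisymm
  · refine famRank_le fun B hB => ?_
    rcases mem_serExt.1 hB with ⟨B', h, rfl⟩ | ⟨B', h, hp, rfl⟩
    · rw [Finset.inter_insert_of_notMem (by simp [hqA, hpq.symm])]
      have := hle B' h
      have := le_famRank h A; omega
    · rw [key]
      have := le_famRank h A; omega
  · obtain ⟨B, hB, hBr⟩ := Finset.exists_mem_eq_sup F hne (fun B => (A ∩ B).card)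
    have : (insert p A ∩ insert p B).card ≤ famRank (serExt F p q) (insert p A) := by
      by_cases hpB : p ∈ B
      · have := le_famRank (mem_serExt (p := p) (q := q).2 (Or.inl ⟨B, hB, rfl⟩)) (insert p A)
        rwa [Finset.inter_insert_of_notMem (by simp [hqA, hpq.symm]),
          ← Finset.insert_eq_of_mem hpB] at this
      · exact le_famRank (mem_serExt (p := p) (q := q).2 (Or.inr ⟨B, hB, hpB, rfl⟩)) (insert p A)
    rw [key] at this
    unfold famRank at this ⊢
    omega

theorem rank_ser_both (hF : ∀ B ∈ F, B ⊆ E) (hne : F.Nonempty) (hq : q ∉ E) (hp : p ∈ E)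
    {A : Finset ℕ} (hA : A ⊆ E) (hpA : p ∉ A) :
    famRank (serExt F p q) (insert q (insert p A)) = famRank F (insert p A) + 1 := by
  have hqA : q ∉ A := fun h => hq (hA h)
  have hpq : p ≠ q := by rintro rfl; exact hq hp
  have hqA' : q ∉ insert p A := by simp [hqA, hpq.symm]
  have key : ∀ B, (insert q (insert p A) ∩ insert q B).card = (insert p A ∩ B).card + 1 := by
    intro B
    rw [← Finset.insert_inter_distrib,
      Finset.card_insert_of_notMem (fun h => hqA' (Finset.mem_of_mem_inter_left h))]
  apply le_antisymm
  · refine famRank_le fun B hB => ?_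
    rcases mem_serExt.1 hB with ⟨B', h, rfl⟩ | ⟨B', h, hp', rfl⟩
    · rw [key]; have := le_famRank h (insert p A); omega
    · rw [Finset.insert_inter_of_notMem, ← Finset.insert_inter_distrib]
      · have := le_famRank h (insert p A)
        rw [Finset.insert_inter_of_notMem hp'] at this
        have := Finset.card_insert_le p (A ∩ B')
        omega
      · simp only [Finset.mem_insert, hpq.symm, false_or]
        exact fun hh => hq (hF _ h hh)
  · obtain ⟨B, hB, hBr⟩ := Finset.exists_mem_eq_sup F hne (fun B => (insert p A ∩ B).card)
    have := le_famRank (mem_serExt (p := p) (q := q).2 (Or.inl ⟨B, hB, rfl⟩))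
      (insert q (insert p A))
    rw [key] at this
    unfold famRank at this ⊢
    omega

theorem sum_powerset_two {G : Finset ℕ} {p q : ℕ} (hp : p ∉ G) (hq : q ∉ insert p G)
    (f : Finset ℕ → ℤ) :
    ∑ A ∈ (insert q (insert p G)).powerset, (-1) ^ A.card * f A
      = ∑ A ∈ G.powerset, (-1) ^ A.card *
        (f A - f (insert p A) - f (insert q A) + f (insert q (insert p A))) := by
  rw [Finset.sum_powerset_insert hq, Finset.sum_powerset_insert hp,
    Finset.sum_powerset_insert hp (fun A => (-1) ^ (insert q A).card * f (insert q A)),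
    ← Finset.sum_add_distrib, ← Finset.sum_add_distrib, ← Finset.sum_add_distrib]
  refine Finset.sum_congr rfl fun A hA => ?_
  have hAG := Finset.mem_powerset.1 hA
  have h1 : p ∉ A := fun h => hp (hAG h)
  have h2 : q ∉ insert p A := fun h => hq (Finset.insert_subset_insert p hAG h)
  have h3 : q ∉ A := fun h => h2 (Finset.mem_insert_of_mem h)
  rw [Finset.card_insert_of_notMem h1, Finset.card_insert_of_notMem h2,
    Finset.card_insert_of_notMem h3, Finset.card_insert_of_notMem h1]
  ring

theorem sum_powerset_one {G : Finset ℕ} {p : ℕ} (hp : p ∉ G) (f : Finset ℕ → ℤ) :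
    ∑ A ∈ (insert p G).powerset, (-1) ^ A.card * f A
      = ∑ A ∈ G.powerset, (-1) ^ A.card * (f A - f (insert p A)) := by
  rw [Finset.sum_powerset_insert hp, ← Finset.sum_add_distrib]
  refine Finset.sum_congr rfl fun A hA => ?_
  have hAG := Finset.mem_powerset.1 hA
  have h1 : p ∉ A := fun h => hp (hAG h)
  rw [Finset.card_insert_of_notMem h1]
  ring

/-- connected series-parallel blocks with a marked element -/
structure Blk (E : Finset ℕ) (F : Finset (Finset ℕ)) (p : ℕ) : Prop where
  sub : ∀ B ∈ F, B ⊆ E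
  card : ∃ s, ∀ B ∈ F, B.card = s
  conn : IsConnectedFam E F
  beta : betaInv E F = 1
  mem : p ∈ E
  basis : ∃ B ∈ F, p ∈ B
  circ : ∃ C, famCircuit F C ∧ p ∈ C
  two : ∃ e ∈ E, e ≠ p

theorem Blk.par (h : Blk E F p) (hq : q ∉ E) : Blk (insert q E) (parExt F p q) q := by
  have hpq : p ≠ q := by rintro rfl; exact hq h.mem
  have hne : F.Nonempty := let ⟨B, hB, _⟩ := h.basis; ⟨B, hB⟩
  obtain ⟨s, hs⟩ := h.card
  have hsub : ∀ B ∈ parExt F p q, B ⊆ insert q E := by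
    intro B hB
    rcases mem_parExt.1 hB with h' | ⟨B', h', hp, rfl⟩
    · exact (h.sub B h').trans (Finset.subset_insert _ _)
    · exact Finset.insert_subset_insert _ ((Finset.erase_subset _ _).trans (h.sub B' h'))
  have hcard : ∀ B ∈ parExt F p q, B.card = s := by
    intro B hB
    rcases mem_parExt.1 hB with h' | ⟨B', h', hp, rfl⟩
    · exact hs B h'
    · rw [card_swap B' hp (fun hh => hq (h.sub B' h' hh)), hs B' h']
  have hind : ∀ S, q ∉ S → (famIndep (parExt F p q) S ↔ famIndep F S) := by
    intro S hqS
    constructor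
    · rintro ⟨B, hB, hSB⟩
      rcases mem_parExt.1 hB with h' | ⟨B', h', hp, rfl⟩
      · exact ⟨B, h', hSB⟩
      · refine ⟨B', h', fun i hi => ?_⟩
        have := hSB hi
        simp only [Finset.mem_insert, Finset.mem_erase] at this
        rcases this with rfl | h2
        · exact absurd hi hqS
        · exact h2.2
    · rintro ⟨B, hB, hSB⟩
      exact ⟨B, mem_parExt.2 (Or.inl hB), hSB⟩
  have hqC : ∀ C, famCircuit F C → ∀ e ∈ C, e ∈ E → q ∉ C := by
    intro C hC e heC heE hqC
    have : ¬ famIndep F {q} := by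
      rintro ⟨B, hB, hS⟩
      exact hq (h.sub B hB (hS (Finset.mem_singleton_self q)))
    refine this (hC.2 {q} ⟨by simpa using hqC, fun hh => ?_⟩)
    have := Finset.mem_singleton.1 (hh heC)
    subst this
    exact hq heE
  have hcirc : ∀ C, famCircuit F C → q ∉ C → famCircuit (parExt F p q) C := by
    intro C hC hqC
    refine ⟨fun hh => hC.1 ((hind C hqC).1 hh), fun C' hC' => ?_⟩
    exact (hind C' (fun hh => hqC (hC'.1 hh))).2 (hC.2 C' hC')
  have hcpq : famCircuit (parExt F p q) {p, q} := by
    obtain ⟨B, hB, hpB⟩ := h.basis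
    constructor
    · rintro ⟨B, hB, hS⟩
      have h1 : p ∈ B := hS (by simp)
      have h2 : q ∈ B := hS (by simp)
      rcases mem_parExt.1 hB with h' | ⟨B', h', hp, rfl⟩
      · exact hq (h.sub B h' h2)
      · simp [hpq] at h1
    · intro C' hC'
      by_cases hqC' : q ∈ C'
      · have hpC' : p ∉ C' := by
          intro hh
          refine hC'.2 ?_
          intro i hi
          rcases Finset.mem_insert.1 hi with rfl | hi
          · exact hh
          · rwa [Finset.mem_singleton.1 hi]
        refine ⟨_, mem_parExt.2 (Or.inr ⟨B, hB, hpB, rfl⟩), fun i hi => ?_⟩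
        have := hC'.1 hi
        simp only [Finset.mem_insert, Finset.mem_singleton] at this
        rcases this with rfl | rfl
        · exact absurd hi hpC'
        · simp
      · refine ⟨B, mem_parExt.2 (Or.inl hB), fun i hi => ?_⟩
        have := hC'.1 hi
        simp only [Finset.mem_insert, Finset.mem_singleton] at this
        rcases this with rfl | rfl
        · exact hpB
        · exact absurd hi hqC'
  have hconn : ∀ e ∈ E, ∀ f, Relation.EqvGen (connRel F) e f →
      f ∈ E → Relation.EqvGen (connRel (parExt F p q)) e f := by
    intro e he f hef _
    refine eqvGen_mono' ?_ hef
    rintro a b (rfl | ⟨C, hC, ha, hb⟩)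
    · exact Or.inl rfl
    · by_cases hqC' : q ∈ C
      · -- C must be the singleton of q
        have hCE : ∀ i ∈ C, i = q := by
          intro i hi
          by_contra hne'
          have : ¬ famIndep F {q} := by
            rintro ⟨B, hB, hS⟩
            exact hq (h.sub B hB (hS (Finset.mem_singleton_self q)))
          refine this (hC.2 {q} ⟨by simpa using hqC', fun hh => ?_⟩)
          exact hne' (Finset.mem_singleton.1 (hh hi))
        exact Or.inl ((hCE a ha).trans (hCE b hb).symm)
      · exact Or.inr ⟨C, hcirc C hC hqC', ha, hb⟩
  have hall : ∀ e ∈ insert q E, Relation.EqvGen (connRel (parExt F p q)) p e := by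
    intro e he
    rcases Finset.mem_insert.1 he with rfl | he
    · exact Relation.EqvGen.rel _ _ (Or.inr ⟨_, hcpq, by simp, by simp⟩)
    · exact hconn p h.mem e (h.conn.2 p h.mem e he) he
  refine ⟨hsub, ⟨s, hcard⟩, ⟨⟨q, by simp⟩, fun e he f hf => ?_⟩, ?_, by simp, ?_, ?_, ?_⟩
  · exact ((hall e he).symm _ _).trans _ _ _ (hall f hf)
  · have hb := h.beta
    have hne' : (parExt F p q).Nonempty := hne.mono (fun B hB => mem_parExt.2 (Or.inl hB))
    unfold betaInv at hb ⊢
    rw [famRank_eq_card hne (fun B hB => ⟨h.sub B hB, hs B hB⟩)] at hb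
    rw [famRank_eq_card hne' (fun B hB => ⟨hsub B hB, hcard B hB⟩)]
    refine Eq.trans ?_ hb
    congr 1
    have hE : E = insert p (E.erase p) := (Finset.insert_erase h.mem).symm
    have h1 : p ∉ E.erase p := by simp
    have h2 : q ∉ insert p (E.erase p) := by rwa [← hE]
    have e1 := sum_powerset_two h1 h2 (fun A => (famRank (parExt F p q) A : ℤ))
    have e2 := sum_powerset_one h1 (fun A => (famRank F A : ℤ))
    rw [← hE] at e1 e2
    rw [e1, e2]
    refine Finset.sum_congr rfl fun A hA => ?_
    have hA' := Finset.mem_powerset.1 hA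
    have hAE : A ⊆ E := hA'.trans (Finset.erase_subset _ _)
    have hpA : p ∉ A := fun hh => h1 (hA' hh)
    rw [rank_par_old h.sub hq hAE, rank_par_new h.sub hq h.mem hAE hpA,
      rank_par_both h.sub hq h.mem hAE hpA,
      rank_par_old h.sub hq (Finset.insert_subset h.mem hAE)]
    ring
  · obtain ⟨B, hB, hpB⟩ := h.basis
    exact ⟨_, mem_parExt.2 (Or.inr ⟨B, hB, hpB, rfl⟩), by simp⟩
  · exact ⟨_, hcpq, by simp⟩
  · exact ⟨p, by simp [h.mem], hpq⟩

theorem Blk.ser (h : Blk E F p) (hq : q ∉ E) : Blk (insert q E) (serExt F p q) q := by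
  have hpq : p ≠ q := by rintro rfl; exact hq h.mem
  have hne : F.Nonempty := let ⟨B, hB, _⟩ := h.basis; ⟨B, hB⟩
  obtain ⟨s, hs⟩ := h.card
  have hqB : ∀ B ∈ F, q ∉ B := fun B hB hh => hq (h.sub B hB hh)
  have hsub : ∀ B ∈ serExt F p q, B ⊆ insert q E := by
    intro B hB
    rcases mem_serExt.1 hB with ⟨B', h', rfl⟩ | ⟨B', h', hp, rfl⟩
    · exact Finset.insert_subset_insert _ (h.sub B' h')
    · exact (Finset.insert_subset h.mem (h.sub B' h')).trans (Finset.subset_insert _ _)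
  have hcard : ∀ B ∈ serExt F p q, B.card = s + 1 := by
    intro B hB
    rcases mem_serExt.1 hB with ⟨B', h', rfl⟩ | ⟨B', h', hp, rfl⟩
    · rw [Finset.card_insert_of_notMem (hqB B' h'), hs B' h']
    · rw [Finset.card_insert_of_notMem hp, hs B' h']
  have hind : ∀ S, famIndep F S → famIndep (serExt F p q) S := by
    rintro S ⟨B, hB, hSB⟩
    exact ⟨_, mem_serExt.2 (Or.inl ⟨B, hB, rfl⟩), hSB.trans (Finset.subset_insert _ _)⟩
  have hind2 : ∀ S, q ∉ S → p ∉ S → famIndep (serExt F p q) S → famIndep F S := by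
    rintro S hqS hpS ⟨B, hB, hSB⟩
    rcases mem_serExt.1 hB with ⟨B', h', rfl⟩ | ⟨B', h', hp, rfl⟩
    · exact ⟨B', h', (Finset.subset_insert_iff_of_notMem hqS).1 hSB⟩
    · exact ⟨B', h', (Finset.subset_insert_iff_of_notMem hpS).1 hSB⟩
  have hcirc1 : ∀ C, famCircuit F C → q ∉ C → p ∉ C → famCircuit (serExt F p q) C := by
    intro C hC hqC hpC
    exact ⟨fun hh => hC.1 (hind2 C hqC hpC hh), fun C' hC' => hind _ (hC.2 C' hC')⟩
  have hcirc2 : ∀ C, famCircuit F C → q ∉ C → p ∈ C → famCircuit (serExt F p q) (insert q C) := by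
    intro C hC hqC hpC
    constructor
    · rintro ⟨B, hB, hSB⟩
      rcases mem_serExt.1 hB with ⟨B', h', rfl⟩ | ⟨B', h', hp, rfl⟩
      · refine hC.1 ⟨B', h', ?_⟩
        exact (Finset.subset_insert_iff_of_notMem hqC).1
          ((Finset.subset_insert _ _).trans hSB)
      · have := hSB (Finset.mem_insert_self q C)
        rcases Finset.mem_insert.1 this with hh | hh
        · exact hpq hh.symm
        · exact hqB B' h' hh
    · intro C' hC'
      by_cases hqC' : q ∈ C'
      · have hlt : C'.erase q ⊂ C := by
          rw [Finset.ssubset_iff_subset_ne]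
          constructor
          · intro i hi
            have h1 := Finset.mem_erase.1 hi
            exact Finset.mem_of_mem_insert_of_ne (hC'.1 h1.2) h1.1
          · intro heq
            apply hC'.2
            rw [← heq, Finset.insert_erase hqC']
        obtain ⟨B, hB, hSB⟩ := hC.2 _ hlt
        refine ⟨_, mem_serExt.2 (Or.inl ⟨B, hB, rfl⟩), ?_⟩
        rw [← Finset.insert_erase hqC']
        exact Finset.insert_subset_insert _ hSB
      · have hsubC : C' ⊆ C := (Finset.subset_insert_iff_of_notMem hqC').1 hC'.1
        have hlt : C'.erase p ⊂ C := by
          rw [Finset.ssubset_iff_subset_ne]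
          refine ⟨(Finset.erase_subset _ _).trans hsubC, fun heq => ?_⟩
          rw [← heq] at hpC
          simp at hpC
        obtain ⟨B, hB, hSB⟩ := hC.2 _ hlt
        have hC'p : C' ⊆ insert p B := by
          rw [Finset.subset_insert_iff]
          exact hSB
        by_cases hpB : p ∈ B
        · rw [Finset.insert_eq_of_mem hpB] at hC'p
          exact hind _ ⟨B, hB, hC'p⟩
        · exact ⟨_, mem_serExt.2 (Or.inr ⟨B, hB, hpB, rfl⟩), hC'p⟩
  have hqs : ∀ C, famCircuit F C → q ∈ C → ∀ i ∈ C, i = q := by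
    intro C hC hqC' i hi
    by_contra hne'
    have : ¬ famIndep F {q} := by
      rintro ⟨B, hB, hS⟩
      exact hq (h.sub B hB (hS (Finset.mem_singleton_self q)))
    refine this (hC.2 {q} ⟨by simpa using hqC', fun hh => ?_⟩)
    exact hne' (Finset.mem_singleton.1 (hh hi))
  obtain ⟨C0, hC0, hpC0⟩ := h.circ
  have hqC0 : q ∉ C0 := fun hh => hpq (hqs C0 hC0 hh p hpC0)
  have hconn : ∀ e f, Relation.EqvGen (connRel F) e f →
      Relation.EqvGen (connRel (serExt F p q)) e f := by
    intro e f hef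
    refine eqvGen_mono' ?_ hef
    rintro a b (rfl | ⟨C, hC, ha, hb⟩)
    · exact Or.inl rfl
    · by_cases hqC' : q ∈ C
      · exact Or.inl ((hqs C hC hqC' a ha).trans (hqs C hC hqC' b hb).symm)
      · by_cases hpC : p ∈ C
        · exact Or.inr ⟨_, hcirc2 C hC hqC' hpC, by simp [ha], by simp [hb]⟩
        · exact Or.inr ⟨C, hcirc1 C hC hqC' hpC, ha, hb⟩
  have hall : ∀ e ∈ insert q E, Relation.EqvGen (connRel (serExt F p q)) p e := by
    intro e he
    rcases Finset.mem_insert.1 he with rfl | he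
    · exact Relation.EqvGen.rel _ _ (Or.inr ⟨_, hcirc2 C0 hC0 hqC0 hpC0, by simp [hpC0], by simp⟩)
    · exact hconn p e (h.conn.2 p h.mem e he)
  refine ⟨hsub, ⟨s + 1, hcard⟩, ⟨⟨q, by simp⟩, fun e he f hf => ?_⟩, ?_, by simp, ?_, ?_, ?_⟩
  · exact ((hall e he).symm _ _).trans _ _ _ (hall f hf)
  · have hb := h.beta
    have hne' : (serExt F p q).Nonempty := by
      obtain ⟨B, hB⟩ := hne
      exact ⟨_, mem_serExt.2 (Or.inl ⟨B, hB, rfl⟩)⟩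
    unfold betaInv at hb ⊢
    rw [famRank_eq_card hne (fun B hB => ⟨h.sub B hB, hs B hB⟩)] at hb
    rw [famRank_eq_card hne' (fun B hB => ⟨hsub B hB, hcard B hB⟩)]
    refine Eq.trans ?_ hb
    have hE : E = insert p (E.erase p) := (Finset.insert_erase h.mem).symm
    have h1 : p ∉ E.erase p := by simp
    have h2 : q ∉ insert p (E.erase p) := by rwa [← hE]
    have e1 := sum_powerset_two h1 h2 (fun A => (famRank (serExt F p q) A : ℤ))
    have e2 := sum_powerset_one h1 (fun A => (famRank F A : ℤ))
    rw [← hE] at e1 e2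
    rw [e1, e2]
    have hz : ∑ A ∈ (E.erase p).powerset, (-1 : ℤ) ^ A.card = 0 := by
      apply Finset.sum_powerset_neg_one_pow_card_of_nonempty
      obtain ⟨e, he, hep⟩ := h.two
      exact ⟨e, Finset.mem_erase.2 ⟨hep, he⟩⟩
    have e3 : ∑ A ∈ (E.erase p).powerset, (-1 : ℤ) ^ A.card *
        ((famRank (serExt F p q) A : ℤ) - famRank (serExt F p q) (insert p A)
          - famRank (serExt F p q) (insert q A)
          + famRank (serExt F p q) (insert q (insert p A)))
        = ∑ A ∈ (E.erase p).powerset, (- ((-1 : ℤ) ^ A.card *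
          ((famRank F A : ℤ) - famRank F (insert p A))) - (-1) ^ A.card) := by
      refine Finset.sum_congr rfl fun A hA => ?_
      have hA' := Finset.mem_powerset.1 hA
      have hAE : A ⊆ E := hA'.trans (Finset.erase_subset _ _)
      have hpA : p ∉ A := fun hh => h1 (hA' hh)
      rw [rank_ser_none h.sub hq hAE hpA, rank_ser_p h.sub hne hq h.mem hAE hpA,
        rank_ser_q h.sub hne hq h.mem hAE hpA, rank_ser_both h.sub hne hq h.mem hAE hpA]
      push_cast
      ring
    rw [e3, Finset.sum_sub_distrib, hz, Finset.sum_neg_distrib]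
    ring
  · obtain ⟨B, hB⟩ := hne
    exact ⟨_, mem_serExt.2 (Or.inl ⟨B, hB, rfl⟩), by simp⟩
  · exact ⟨_, hcirc2 C0 hC0 hqC0 hpC0, by simp⟩
  · exact ⟨p, by simp [h.mem], hpq⟩

end ext

theorem Blk.base {a b : ℕ} (hab : a ≠ b) : Blk {a, b} {{a}, {b}} b := by
  have hcab : famCircuit {{a}, {b}} {a, b} := by
    constructor
    · rintro ⟨B, hB, hS⟩
      have h1 : a ∈ B := hS (by simp)
      have h2 : b ∈ B := hS (by simp)
      simp only [Finset.mem_insert, Finset.mem_singleton] at hB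
      rcases hB with rfl | rfl
      · exact hab (Finset.mem_singleton.1 h2).symm
      · exact hab (Finset.mem_singleton.1 h1)
    · intro C' hC'
      by_cases haC : a ∈ C'
      · refine ⟨{a}, by simp, fun i hi => ?_⟩
        have := hC'.1 hi
        simp only [Finset.mem_insert, Finset.mem_singleton] at this
        rcases this with rfl | rfl
        · simp
        · exact absurd (Finset.insert_subset haC (by simpa using hi)) hC'.2
      · refine ⟨{b}, by simp, fun i hi => ?_⟩
        have := hC'.1 hi
        simp only [Finset.mem_insert, Finset.mem_singleton] at this
        rcases this with rfl | rfl
        · exact absurd hi haC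
        · simp
  have hall : ∀ e ∈ ({a, b} : Finset ℕ), ∀ f ∈ ({a, b} : Finset ℕ),
      Relation.EqvGen (connRel {{a}, {b}}) e f := fun e he f hf =>
    Relation.EqvGen.rel _ _ (Or.inr ⟨_, hcab, he, hf⟩)
  refine ⟨?_, ⟨1, ?_⟩, ⟨⟨a, by simp⟩, hall⟩, ?_, by simp, ⟨{b}, by simp, by simp⟩,
    ⟨_, hcab, by simp⟩, ⟨a, by simp, hab⟩⟩
  · intro B hB
    simp only [Finset.mem_insert, Finset.mem_singleton] at hB
    rcases hB with rfl | rfl <;> simp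
  · intro B hB
    simp only [Finset.mem_insert, Finset.mem_singleton] at hB
    rcases hB with rfl | rfl <;> simp
  · have e := sum_powerset_two (G := ∅) (p := a) (q := b) (by simp) (by simpa using hab.symm)
      (fun A => (famRank {{a}, {b}} A : ℤ))
    unfold betaInv
    have h3 : ({a, b} : Finset ℕ) = insert b (insert a ∅) := by
      ext i; simp; tauto
    rw [h3, e]
    have r1 : famRank {{a}, {b}} ∅ = 0 := by simp [famRank]
    have r2 : famRank {{a}, {b}} (insert a ∅) = 1 := by
      simp [famRank, hab]
    have r3 : famRank {{a}, {b}} (insert b ∅) = 1 := by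
      simp [famRank, hab.symm]
    have r4 : famRank {{a}, {b}} (insert b (insert a ∅)) = 1 := by
      simp [famRank]
    simp only [Finset.powerset_empty, Finset.sum_singleton, r1, r2, r3, r4]
    norm_num

/-! ### Direct sums of families -/

/-- direct sum of two basis families -/
noncomputable def dsum (F0 F1 : Finset (Finset ℕ)) : Finset (Finset ℕ) :=
  (F0 ×ˢ F1).image fun p => p.1 ∪ p.2

theorem mem_dsum {F0 F1 : Finset (Finset ℕ)} {B : Finset ℕ} :
    B ∈ dsum F0 F1 ↔ ∃ B0 ∈ F0, ∃ B1 ∈ F1, B0 ∪ B1 = B := by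
  simp only [dsum, Finset.mem_image, Finset.mem_product, Prod.exists]
  constructor
  · rintro ⟨a, b, ⟨h1, h2⟩, h⟩; exact ⟨a, h1, b, h2, h⟩
  · rintro ⟨a, h1, b, h2, h⟩; exact ⟨a, b, ⟨h1, h2⟩, h⟩

theorem dsum_comm (F0 F1 : Finset (Finset ℕ)) : dsum F0 F1 = dsum F1 F0 := by
  ext B
  simp only [mem_dsum]
  constructor
  · rintro ⟨a, h1, b, h2, h⟩; exact ⟨b, h2, a, h1, by rw [Finset.union_comm, h]⟩
  · rintro ⟨a, h1, b, h2, h⟩; exact ⟨b, h2, a, h1, by rw [Finset.union_comm, h]⟩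

theorem union_inter_left' {B0 B1 E0 E1 S : Finset ℕ} (h1 : B1 ⊆ E1) (hd : Disjoint E0 E1)
    (hS : S ⊆ E0) : (B0 ∪ B1) ∩ S = B0 ∩ S := by
  ext i
  simp only [Finset.mem_inter, Finset.mem_union]
  constructor
  · rintro ⟨h | h, hi⟩
    · exact ⟨h, hi⟩
    · exact absurd (h1 h) (Finset.disjoint_left.1 hd (hS hi))
  · rintro ⟨h, hi⟩; exact ⟨Or.inl h, hi⟩

theorem image_dsum {F0 F1 : Finset (Finset ℕ)} {E0 E1 S : Finset ℕ}
    (hs1 : ∀ B ∈ F1, B ⊆ E1) (hne1 : F1.Nonempty) (hd : Disjoint E0 E1) (hS : S ⊆ E0) :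
    (dsum F0 F1).image (· ∩ S) = F0.image (· ∩ S) := by
  ext B
  simp only [Finset.mem_image]
  constructor
  · rintro ⟨C, hC, rfl⟩
    obtain ⟨B0, h0, B1, h1, rfl⟩ := mem_dsum.1 hC
    exact ⟨B0, h0, (union_inter_left' (hs1 B1 h1) hd hS).symm⟩
  · rintro ⟨B0, h0, rfl⟩
    obtain ⟨B1, h1⟩ := hne1
    exact ⟨B0 ∪ B1, mem_dsum.2 ⟨B0, h0, B1, h1, rfl⟩, union_inter_left' (hs1 B1 h1) hd hS⟩

theorem famRestrict_dsum {F0 F1 : Finset (Finset ℕ)} {E0 E1 S : Finset ℕ}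
    (hs1 : ∀ B ∈ F1, B ⊆ E1) (hne1 : F1.Nonempty) (hd : Disjoint E0 E1) (hS : S ⊆ E0) :
    famRestrict (dsum F0 F1) S = famRestrict F0 S := by
  unfold famRestrict
  rw [image_dsum hs1 hne1 hd hS]

theorem famRestrict_self {F : Finset (Finset ℕ)} {E : Finset ℕ}
    (hs : ∀ B ∈ F, B ⊆ E) {s : ℕ} (hc : ∀ B ∈ F, B.card = s) : famRestrict F E = F := by
  have : F.image (· ∩ E) = F := by
    ext B
    simp only [Finset.mem_image]
    constructor
    · rintro ⟨C, hC, rfl⟩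
      rwa [Finset.inter_eq_left.2 (hs C hC)]
    · intro hB
      exact ⟨B, hB, Finset.inter_eq_left.2 (hs B hB)⟩
  unfold famRestrict
  rw [this]
  refine Finset.filter_true_of_mem fun S hS T hT hST => ?_
  exact Finset.eq_of_subset_of_card_le hST (by rw [hc S hS, hc T hT])

theorem circuit_sub {F : Finset (Finset ℕ)} {E C : Finset ℕ} (hs : ∀ B ∈ F, B ⊆ E)
    (hC : famCircuit F C) {e : ℕ} (he : e ∈ C) (heE : e ∈ E) : C ⊆ E := by
  intro q hqC
  by_contra hq
  have : ¬ famIndep F {q} := by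
    rintro ⟨B, hB, hS⟩
    exact hq (hs B hB (hS (Finset.mem_singleton_self q)))
  refine this (hC.2 {q} ⟨by simpa using hqC, fun hh => ?_⟩)
  have := Finset.mem_singleton.1 (hh he)
  subst this
  exact hq heE

theorem dsum_indep_left {F0 F1 : Finset (Finset ℕ)} {E0 E1 S : Finset ℕ}
    (hs1 : ∀ B ∈ F1, B ⊆ E1) (hne1 : F1.Nonempty) (hd : Disjoint E0 E1) (hS : S ⊆ E0) :
    famIndep (dsum F0 F1) S ↔ famIndep F0 S := by
  constructor
  · rintro ⟨B, hB, hSB⟩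
    obtain ⟨B0, h0, B1, h1, rfl⟩ := mem_dsum.1 hB
    refine ⟨B0, h0, fun i hi => ?_⟩
    rcases Finset.mem_union.1 (hSB hi) with h | h
    · exact h
    · exact absurd (hs1 B1 h1 h) (Finset.disjoint_left.1 hd (hS hi))
  · rintro ⟨B0, h0, h⟩
    obtain ⟨B1, h1⟩ := hne1
    exact ⟨B0 ∪ B1, mem_dsum.2 ⟨B0, h0, B1, h1, rfl⟩, h.trans Finset.subset_union_left⟩

theorem dsum_circuit_left {F0 F1 : Finset (Finset ℕ)} {E0 E1 S : Finset ℕ}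
    (hs1 : ∀ B ∈ F1, B ⊆ E1) (hne1 : F1.Nonempty) (hd : Disjoint E0 E1) (hS : S ⊆ E0) :
    famCircuit (dsum F0 F1) S ↔ famCircuit F0 S := by
  unfold famCircuit
  rw [dsum_indep_left hs1 hne1 hd hS]
  refine and_congr_right fun _ => forall_congr' fun C' => forall_congr' fun hC' => ?_
  rw [dsum_indep_left hs1 hne1 hd (hC'.1.trans hS)]

theorem dsum_circuit_sub {F0 F1 : Finset (Finset ℕ)} {E0 E1 C : Finset ℕ}
    (hs0 : ∀ B ∈ F0, B ⊆ E0) (hne0 : F0.Nonempty)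
    (hs1 : ∀ B ∈ F1, B ⊆ E1) (hne1 : F1.Nonempty) (hd : Disjoint E0 E1)
    (hC : famCircuit (dsum F0 F1) C) {e : ℕ} (he : e ∈ C) (heE : e ∈ E0) : C ⊆ E0 := by
  have hsub : ∀ B ∈ dsum F0 F1, B ⊆ E0 ∪ E1 := by
    intro B hB
    obtain ⟨B0, h0, B1, h1, rfl⟩ := mem_dsum.1 hB
    exact Finset.union_subset_union (hs0 _ h0) (hs1 _ h1)
  have hCE := circuit_sub hsub hC he (Finset.mem_union_left _ heE)
  by_contra hnot
  have h0 : famIndep F0 (C ∩ E0) := by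
    rw [← dsum_indep_left (F0 := F0) hs1 hne1 hd Finset.inter_subset_right]
    refine hC.2 _ ⟨Finset.inter_subset_left, fun h => hnot (h.trans Finset.inter_subset_right)⟩
  have h1 : famIndep F1 (C ∩ E1) := by
    rw [← dsum_indep_left (F0 := F1) hs0 hne0 hd.symm Finset.inter_subset_right, dsum_comm]
    refine hC.2 _ ⟨Finset.inter_subset_left, fun h => ?_⟩
    exact Finset.disjoint_left.1 hd heE (Finset.inter_subset_right (h he))
  obtain ⟨B0, hB0, hs⟩ := h0
  obtain ⟨B1, hB1, ht⟩ := h1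
  refine hC.1 ⟨B0 ∪ B1, mem_dsum.2 ⟨B0, hB0, B1, hB1, rfl⟩, fun i hi => ?_⟩
  rcases Finset.mem_union.1 (hCE hi) with h | h
  · exact Finset.mem_union_left _ (hs (Finset.mem_inter.2 ⟨hi, h⟩))
  · exact Finset.mem_union_right _ (ht (Finset.mem_inter.2 ⟨hi, h⟩))

theorem eqvGen_on {R S : ℕ → ℕ → Prop} {E : Finset ℕ}
    (h : ∀ a b, R a b → (a ∈ E ∨ b ∈ E) → a ∈ E ∧ b ∈ E ∧ S a b) {e f : ℕ}
    (hef : Relation.EqvGen R e f) :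
    (e ∈ E ↔ f ∈ E) ∧ (e ∈ E → Relation.EqvGen S e f) := by
  induction hef with
  | rel a b hab =>
    have := h a b hab
    exact ⟨⟨fun ha => (this (Or.inl ha)).2.1, fun hb => (this (Or.inr hb)).1⟩,
      fun ha => Relation.EqvGen.rel _ _ (this (Or.inl ha)).2.2⟩
  | refl a => exact ⟨Iff.rfl, fun _ => Relation.EqvGen.refl a⟩
  | symm a b _ ih => exact ⟨ih.1.symm, fun hb => (ih.2 (ih.1.2 hb)).symm _ _⟩
  | trans a b c _ _ ih1 ih2 =>
    exact ⟨ih1.1.trans ih2.1, fun ha => (ih1.2 ha).trans _ _ _ (ih2.2 (ih1.1.1 ha))⟩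

theorem dsum_class {F0 F1 : Finset (Finset ℕ)} {E0 E1 : Finset ℕ}
    (hs0 : ∀ B ∈ F0, B ⊆ E0) (hne0 : F0.Nonempty)
    (hs1 : ∀ B ∈ F1, B ⊆ E1) (hne1 : F1.Nonempty) (hd : Disjoint E0 E1) {e : ℕ} (he : e ∈ E0) :
    {f | f ∈ E0 ∪ E1 ∧ Relation.EqvGen (connRel (dsum F0 F1)) e f}
      = {f | f ∈ E0 ∧ Relation.EqvGen (connRel F0) e f} := by
  have h1 : ∀ a b, connRel (dsum F0 F1) a b → (a ∈ E0 ∨ b ∈ E0) →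
      a ∈ E0 ∧ b ∈ E0 ∧ connRel F0 a b := by
    rintro a b (rfl | ⟨C, hC, ha, hb⟩) hor
    · exact ⟨by tauto, by tauto, Or.inl rfl⟩
    · have hsub : C ⊆ E0 := by
        rcases hor with h | h
        · exact dsum_circuit_sub hs0 hne0 hs1 hne1 hd hC ha h
        · exact dsum_circuit_sub hs0 hne0 hs1 hne1 hd hC hb h
      exact ⟨hsub ha, hsub hb,
        Or.inr ⟨C, (dsum_circuit_left hs1 hne1 hd hsub).1 hC, ha, hb⟩⟩
  have h2 : ∀ a b, connRel F0 a b → (a ∈ E0 ∨ b ∈ E0) →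
      a ∈ E0 ∧ b ∈ E0 ∧ connRel (dsum F0 F1) a b := by
    rintro a b (rfl | ⟨C, hC, ha, hb⟩) hor
    · exact ⟨by tauto, by tauto, Or.inl rfl⟩
    · have hsub : C ⊆ E0 := by
        rcases hor with h | h
        · exact circuit_sub hs0 hC ha h
        · exact circuit_sub hs0 hC hb h
      exact ⟨hsub ha, hsub hb,
        Or.inr ⟨C, (dsum_circuit_left hs1 hne1 hd hsub).2 hC, ha, hb⟩⟩
  ext f
  simp only [Set.mem_ofPred_eq]
  constructor
  · rintro ⟨_, h⟩
    have := eqvGen_on h1 h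
    exact ⟨this.1.1 he, this.2 he⟩
  · rintro ⟨hf, h⟩
    exact ⟨Finset.mem_union_left _ hf, (eqvGen_on h2 h).2 he⟩

/-- a direct sum of series-parallel matroids with `c` components -/
structure DS (E : Finset ℕ) (F : Finset (Finset ℕ)) (c : ℕ) : Prop where
  ne : F.Nonempty
  sub : ∀ B ∈ F, B ⊆ E
  isDS : IsDirectSumOfSeriesParallel E F
  num : numComponents E F = c

theorem DS.empty : DS ∅ {∅} 0 := by
  refine ⟨by simp, by simp, ⟨∅, by simp, by simp, by simp, by ext; simp⟩, ?_⟩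
  simp [numComponents]

theorem Blk.ne {E : Finset ℕ} {F : Finset (Finset ℕ)} {p : ℕ} (h : Blk E F p) : F.Nonempty :=
  let ⟨B, hB, _⟩ := h.basis; ⟨B, hB⟩

theorem DS.add {E0 E1 : Finset ℕ} {F0 F1 : Finset (Finset ℕ)} {c p : ℕ} (h0 : DS E0 F0 c)
    (h1 : Blk E1 F1 p) (hd : Disjoint E0 E1) : DS (E0 ∪ E1) (dsum F0 F1) (c + 1) := by
  obtain ⟨B00, hB00⟩ := h0.ne
  obtain ⟨B11, hB11⟩ := h1.ne
  obtain ⟨s, hs⟩ := h1.card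
  have hE1 : famRestrict (dsum F0 F1) E1 = F1 := by
    rw [dsum_comm, famRestrict_dsum h0.sub h0.ne hd.symm (Finset.Subset.refl _),
      famRestrict_self h1.sub hs]
  refine ⟨⟨_, mem_dsum.2 ⟨_, hB00, _, hB11, rfl⟩⟩, ?_, ?_, ?_⟩
  · intro B hB
    obtain ⟨B0, h0', B1, h1', rfl⟩ := mem_dsum.1 hB
    exact Finset.union_subset_union (h0.sub _ h0') (h1.sub _ h1')
  · obtain ⟨parts, hpd, hsup, hsp, hF⟩ := h0.isDS
    have hpE : ∀ S ∈ parts, S ⊆ E0 := by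
      intro S hS
      rw [← hsup]
      exact Finset.le_sup (f := id) hS
    refine ⟨insert E1 parts, ?_, ?_, ?_, ?_⟩
    · rw [Finset.coe_insert]
      refine hpd.insert fun S hS _ => ?_
      exact (Finset.disjoint_of_subset_left (hpE S hS) hd).symm
    · rw [Finset.sup_insert, hsup, id, Finset.union_comm]; rfl
    · intro S hS
      rcases Finset.mem_insert.1 hS with rfl | hS
      · rw [hE1]; exact Or.inr ⟨h1.conn, h1.beta⟩
      · rw [famRestrict_dsum h1.sub h1.ne hd (hpE S hS)]
        exact hsp S hS
    · ext B
      rw [mem_dsum, Finset.mem_filter, Finset.mem_powerset]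
      constructor
      · rintro ⟨B0, h0', B1, h1', rfl⟩
        refine ⟨Finset.union_subset_union (h0.sub _ h0') (h1.sub _ h1'), fun S hS => ?_⟩
        rcases Finset.mem_insert.1 hS with rfl | hS
        · rw [hE1, Finset.union_comm, union_inter_left' (h0.sub _ h0') hd.symm
            (Finset.Subset.refl _), Finset.inter_eq_left.2 (h1.sub _ h1')]
          exact h1'
        · rw [famRestrict_dsum h1.sub h1.ne hd (hpE S hS),
            union_inter_left' (h1.sub _ h1') hd (hpE S hS)]
          rw [hF] at h0'
          exact (Finset.mem_filter.1 h0').2 S hS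
      · rintro ⟨hB, hall⟩
        refine ⟨B ∩ E0, ?_, B ∩ E1, ?_, ?_⟩
        · rw [hF, Finset.mem_filter, Finset.mem_powerset]
          refine ⟨Finset.inter_subset_right, fun S hS => ?_⟩
          have := hall S (Finset.mem_insert_of_mem hS)
          rw [famRestrict_dsum h1.sub h1.ne hd (hpE S hS)] at this
          rwa [Finset.inter_assoc, Finset.inter_eq_right.2 (hpE S hS)]
        · have := hall E1 (Finset.mem_insert_self _ _)
          rwa [hE1] at this
        · rw [← Finset.inter_union_distrib_left, Finset.inter_eq_left.2 hB]
  · rw [← h0.num]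
    unfold numComponents
    have hset : {S : Set ℕ | ∃ e ∈ E0 ∪ E1,
        S = {f | f ∈ E0 ∪ E1 ∧ Relation.EqvGen (connRel (dsum F0 F1)) e f}}
        = insert (↑E1 : Set ℕ)
          {S : Set ℕ | ∃ e ∈ E0, S = {f | f ∈ E0 ∧ Relation.EqvGen (connRel F0) e f}} := by
      have hc1 : ∀ e ∈ E1,
          {f | f ∈ E0 ∪ E1 ∧ Relation.EqvGen (connRel (dsum F0 F1)) e f} = (↑E1 : Set ℕ) := by
        intro e he
        rw [Finset.union_comm, dsum_comm, dsum_class h1.sub h1.ne h0.sub h0.ne hd.symm he]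
        ext f
        simp only [Set.mem_ofPred_eq, Finset.mem_coe]
        exact ⟨fun h => h.1, fun h => ⟨h, h1.conn.2 e he f h⟩⟩
      ext S
      simp only [Set.mem_ofPred_eq, Set.mem_insert_iff]
      constructor
      · rintro ⟨e, he, rfl⟩
        rcases Finset.mem_union.1 he with h | h
        · exact Or.inr ⟨e, h, dsum_class h0.sub h0.ne h1.sub h1.ne hd h⟩
        · exact Or.inl (hc1 e h)
      · rintro (rfl | ⟨e, he, rfl⟩)
        · exact ⟨p, Finset.mem_union_right _ h1.mem, (hc1 p h1.mem).symm⟩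
        · exact ⟨e, Finset.mem_union_left _ he,
            (dsum_class h0.sub h0.ne h1.sub h1.ne hd he).symm⟩
    have hfin : {S : Set ℕ | ∃ e ∈ E0,
        S = {f | f ∈ E0 ∧ Relation.EqvGen (connRel F0) e f}}.Finite := by
      refine (E0.finite_toSet.image
        (fun e => {f | f ∈ E0 ∧ Relation.EqvGen (connRel F0) e f})).subset ?_
      rintro S ⟨e, he, rfl⟩
      exact ⟨e, he, rfl⟩
    rw [hset, Set.ncard_insert_of_notMem ?_ hfin]
    rintro ⟨e, he, hS⟩
    have : p ∈ (↑E1 : Set ℕ) := h1.mem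
    rw [hS] at this
    exact Finset.disjoint_left.1 hd this.1 h1.mem

theorem parExt_dsum {F0 F1 : Finset (Finset ℕ)} {E0 : Finset ℕ} {p q : ℕ}
    (hs0 : ∀ B ∈ F0, B ⊆ E0) (hp : p ∉ E0) :
    parExt (dsum F0 F1) p q = dsum F0 (parExt F1 p q) := by
  have key : ∀ B0 ∈ F0, ∀ B1, insert q ((B0 ∪ B1).erase p) = B0 ∪ insert q (B1.erase p) := by
    intro B0 h0 B1
    rw [Finset.erase_union_distrib, Finset.erase_eq_of_notMem (fun h => hp (hs0 _ h0 h)),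
      Finset.union_insert]
  ext B
  simp only [mem_parExt, mem_dsum]
  constructor
  · rintro (⟨B0, h0, B1, h1, rfl⟩ | ⟨B', ⟨B0, h0, B1, h1, rfl⟩, hpB, rfl⟩)
    · exact ⟨B0, h0, B1, Or.inl h1, rfl⟩
    · refine ⟨B0, h0, _, Or.inr ⟨B1, h1, ?_, rfl⟩, (key B0 h0 B1).symm⟩
      rcases Finset.mem_union.1 hpB with h | h
      · exact absurd (hs0 _ h0 h) hp
      · exact h
  · rintro ⟨B0, h0, B1', (h1 | ⟨B1, h1, hpB, rfl⟩), rfl⟩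
    · exact Or.inl ⟨B0, h0, B1', h1, rfl⟩
    · exact Or.inr ⟨_, ⟨B0, h0, B1, h1, rfl⟩, Finset.mem_union_right _ hpB, key B0 h0 B1⟩

theorem serExt_dsum {F0 F1 : Finset (Finset ℕ)} {E0 : Finset ℕ} {p q : ℕ}
    (hs0 : ∀ B ∈ F0, B ⊆ E0) (hp : p ∉ E0) :
    serExt (dsum F0 F1) p q = dsum F0 (serExt F1 p q) := by
  ext B
  simp only [mem_serExt, mem_dsum]
  constructor
  · rintro (⟨B', ⟨B0, h0, B1, h1, rfl⟩, rfl⟩ | ⟨B', ⟨B0, h0, B1, h1, rfl⟩, hpB, rfl⟩)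
    · exact ⟨B0, h0, _, Or.inl ⟨B1, h1, rfl⟩, Finset.union_insert _ _ _⟩
    · refine ⟨B0, h0, _, Or.inr ⟨B1, h1, ?_, rfl⟩, Finset.union_insert _ _ _⟩
      exact fun h => hpB (Finset.mem_union_right _ h)
  · rintro ⟨B0, h0, B1', (⟨B1, h1, rfl⟩ | ⟨B1, h1, hpB, rfl⟩), rfl⟩
    · exact Or.inl ⟨_, ⟨B0, h0, B1, h1, rfl⟩, (Finset.union_insert _ _ _).symm⟩
    · refine Or.inr ⟨_, ⟨B0, h0, B1, h1, rfl⟩, ?_, (Finset.union_insert _ _ _).symm⟩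
      intro h
      rcases Finset.mem_union.1 h with h | h
      · exact hp (hs0 _ h0 h)
      · exact hpB h

/-! ### States of a path -/

/-- bounds on partial sums determined by a path -/
structure St where
  K : ℕ
  c : ℕ
  lo : ℕ → ℕ
  hi : ℕ → ℕ

/-- the initial state -/
def initSt : St := ⟨1, 0, fun _ => 0, fun k => if k = 0 then 0 else 1⟩

/-- the effect of a step on the state -/
def stepSt (s : St) : DStep → St
  | .east => ⟨s.K + 1, s.c, Function.update s.lo (s.K + 1) s.c,
      Function.update s.hi (s.K + 1) (s.c + 1)⟩
  | .north => ⟨s.K + 1, s.c + 1, Function.update s.lo (s.K + 1) (s.c + 1),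
      Function.update s.hi (s.K + 1) (s.c + 2)⟩
  | .diag => ⟨s.K + 2, s.c + 1,
      Function.update (Function.update s.lo (s.K + 1) (s.c + 1)) (s.K + 2) (s.c + 1),
      Function.update (Function.update s.hi (s.K + 1) (s.c + 1)) (s.K + 2) (s.c + 2)⟩

/-- the state of a path -/
def st (P : List DStep) : St := P.foldl stepSt initSt

theorem st_nil : st [] = initSt := rfl

theorem st_snoc (P : List DStep) (d : DStep) : st (P ++ [d]) = stepSt (st P) d := by
  simp [st]

/-- basic invariants of states -/
structure Inv (s : St) : Prop where
  K1 : 1 ≤ s.K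
  lo0 : s.lo 0 = 0
  hi0 : s.hi 0 = 0
  loK : s.lo s.K = s.c
  hiK : s.hi s.K = s.c + 1
  le : ∀ k, s.lo k ≤ s.hi k
  le1 : ∀ k, s.hi k ≤ s.lo k + 1

theorem inv_step {s : St} (h : Inv s) (d : DStep) : Inv (stepSt s d) := by
  have hK := h.K1
  cases d
  · refine ⟨by simp [stepSt], by simp [stepSt, h.lo0],
      by simp [stepSt, h.hi0], by simp [stepSt], by simp [stepSt], ?_, ?_⟩
    · intro k
      have := h.le k
      simp only [stepSt, Function.update_apply]
      split_ifs <;> omega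
    · intro k
      have := h.le1 k
      simp only [stepSt, Function.update_apply]
      split_ifs <;> omega
  · refine ⟨by simp [stepSt], by simp [stepSt, h.lo0],
      by simp [stepSt, h.hi0], by simp [stepSt], by simp [stepSt], ?_, ?_⟩
    · intro k
      have := h.le k
      simp only [stepSt, Function.update_apply]
      split_ifs <;> omega
    · intro k
      have := h.le1 k
      simp only [stepSt, Function.update_apply]
      split_ifs <;> omega
  · refine ⟨by simp [stepSt], by simp [stepSt, h.lo0],
      by simp [stepSt, h.hi0], by simp [stepSt], by simp [stepSt], ?_, ?_⟩
    · intro k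
      have := h.le k
      simp only [stepSt, Function.update_apply]
      split_ifs <;> omega
    · intro k
      have := h.le1 k
      simp only [stepSt, Function.update_apply]
      split_ifs <;> omega

theorem inv_st (P : List DStep) : Inv (st P) := by
  induction P using List.reverseRecOn with
  | nil =>
    refine ⟨by simp [st, initSt], by simp [st, initSt], by simp [st, initSt], by simp [st, initSt],
      by simp [st, initSt], ?_, ?_⟩ <;>
    · intro k
      simp only [st_nil, initSt]
      split_ifs <;> omega
  | append_singleton P d ih => rw [st_snoc]; exact inv_step ih d

/-- the family of a state -/
noncomputable def famSt (s : St) : Finset (Finset ℕ) := Fam (s.K + 1) (s.c + 1) s.lo s.hi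

theorem sub_Icc_pred {B : Finset ℕ} {N : ℕ} (h : B ⊆ Finset.Icc 1 (N + 1)) (hN : N + 1 ∉ B) :
    B ⊆ Finset.Icc 1 N := by
  intro i hi
  have h1 := Finset.mem_Icc.1 (h hi)
  have : i ≠ N + 1 := by rintro rfl; exact hN hi
  exact Finset.mem_Icc.2 ⟨h1.1, by omega⟩

theorem sub_Icc_succ {B : Finset ℕ} {N M : ℕ} (h : B ⊆ Finset.Icc 1 N) (hN : N ≤ M) :
    B ⊆ Finset.Icc 1 M :=
  h.trans (Finset.Icc_subset_Icc_right hN)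

theorem notMem_of_sub {B : Finset ℕ} {N i : ℕ} (h : B ⊆ Finset.Icc 1 N) (hN : N < i) : i ∉ B :=
  fun hi => by have := (Finset.mem_Icc.1 (h hi)).2; omega

theorem fam_east {s : St} (hs : Inv s) :
    famSt (stepSt s .east) = parExt (famSt s) (s.K + 1) (s.K + 2) := by
  have hupd : ∀ k, k ≤ s.K → (stepSt s .east).lo k = s.lo k ∧ (stepSt s .east).hi k = s.hi k := by
    intro k hk
    have : k ≠ s.K + 1 := by omega
    simp [stepSt, this]
  have hlast : (stepSt s .east).lo (s.K + 1) = s.c ∧ (stepSt s .east).hi (s.K + 1) = s.c + 1 := by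
    simp [stepSt]
  have hloK := hs.loK
  have hhiK := hs.hiK
  ext B
  rw [mem_parExt]
  unfold famSt
  simp only [mem_Fam]
  change (B ⊆ Finset.Icc 1 (s.K + 2) ∧ B.card = s.c + 1 ∧ ∀ k < s.K + 2, _) ↔ _
  constructor
  · rintro ⟨hB, hc, hk⟩
    have hcN := cnt_eq_card B _ hB
    by_cases h2 : s.K + 2 ∈ B
    · right
      have e1 : cnt B (s.K + 2) = cnt B (s.K + 1) + 1 := (mem_iff_cnt B (s.K + 1)).1 h2
      have h1 : s.K + 1 ∉ B := by
        intro h1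
        have e2 := (mem_iff_cnt B s.K).1 h1
        have := hk s.K (by omega)
        rw [(hupd s.K le_rfl).1] at this
        omega
      refine ⟨insert (s.K + 1) (B.erase (s.K + 2)), ⟨?_, ?_, ?_⟩, by simp, ?_⟩
      · intro i hi
        rcases Finset.mem_insert.1 hi with rfl | hi
        · simp
        · have h3 := Finset.mem_erase.1 hi
          have h4 := Finset.mem_Icc.1 (hB h3.2)
          exact Finset.mem_Icc.2 ⟨h4.1, by omega⟩
      · rw [card_swap B h2 h1, hc]
      · intro k hk'
        have e := cnt_swap B k h2 h1 (by omega) (by omega)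
        rw [if_neg (by omega), if_neg (by omega)] at e
        have := hk k (by omega)
        rw [(hupd k (by omega)).1, (hupd k (by omega)).2] at this
        omega
      · rw [Finset.erase_insert (by simp [h1]), Finset.insert_erase h2]
    · left
      refine ⟨sub_Icc_pred hB h2, hc, fun k hk' => ?_⟩
      have := hk k (by omega)
      rwa [(hupd k (by omega)).1, (hupd k (by omega)).2] at this
  · rintro (⟨hB, hc, hk⟩ | ⟨B', ⟨hB, hc, hk⟩, hp, rfl⟩)
    · refine ⟨sub_Icc_succ hB (by omega), hc, fun k hk' => ?_⟩
      have hcN := cnt_eq_card B _ hB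
      rcases Nat.lt_or_ge k (s.K + 1) with h | h
      · rw [(hupd k (by omega)).1, (hupd k (by omega)).2]; exact hk k h
      · have : k = s.K + 1 := by omega
        subst this
        rw [hlast.1, hlast.2]; omega
    · have h2 : s.K + 2 ∉ B' := notMem_of_sub hB (by omega)
      have hcN := cnt_eq_card B' _ hB
      refine ⟨?_, by rw [card_swap B' hp h2, hc], fun k hk' => ?_⟩
      · refine Finset.insert_subset (by simp) ?_
        exact (Finset.erase_subset _ _).trans (sub_Icc_succ hB (by omega))
      · have e := cnt_swap B' k hp h2 (by omega) (by omega)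
        rw [if_neg (show ¬ s.K + 2 ≤ k by omega)] at e
        rcases Nat.lt_or_ge k (s.K + 1) with h | h
        · rw [(hupd k (by omega)).1, (hupd k (by omega)).2]
          rw [if_neg (by omega)] at e
          have := hk k h
          omega
        · have : k = s.K + 1 := by omega
          subst this
          rw [if_pos le_rfl] at e
          rw [hlast.1, hlast.2]; omega

theorem fam_north {s : St} (hs : Inv s) :
    famSt (stepSt s .north) = serExt (famSt s) (s.K + 1) (s.K + 2) := by
  have hupd : ∀ k, k ≤ s.K → (stepSt s .north).lo k = s.lo k ∧ (stepSt s .north).hi k = s.hi k := by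
    intro k hk
    have : k ≠ s.K + 1 := by omega
    simp [stepSt, this]
  have hlast : (stepSt s .north).lo (s.K + 1) = s.c + 1 ∧
      (stepSt s .north).hi (s.K + 1) = s.c + 2 := by
    simp [stepSt]
  have hloK := hs.loK
  have hhiK := hs.hiK
  ext B
  rw [mem_serExt]
  unfold famSt
  simp only [mem_Fam]
  change (B ⊆ Finset.Icc 1 (s.K + 2) ∧ B.card = s.c + 2 ∧ ∀ k < s.K + 2, _) ↔ _
  constructor
  · rintro ⟨hB, hc, hk⟩
    have hcN := cnt_eq_card B _ hB
    by_cases h2 : s.K + 2 ∈ B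
    · left
      have hce := Finset.card_erase_add_one h2
      refine ⟨B.erase (s.K + 2), ⟨?_, by omega, ?_⟩, Finset.insert_erase h2⟩
      · exact sub_Icc_pred ((Finset.erase_subset _ _).trans hB) (by simp)
      · intro k hk'
        have e := cnt_erase B k h2 (by omega)
        rw [if_neg (by omega)] at e
        have := hk k (by omega)
        rw [(hupd k (by omega)).1, (hupd k (by omega)).2] at this
        omega
    · right
      have e1 : cnt B (s.K + 2) = cnt B (s.K + 1) := by
        rw [cnt_succ B (s.K + 1), if_neg h2, add_zero]
      have h1 : s.K + 1 ∈ B := by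
        by_contra h1
        have e2 : cnt B (s.K + 1) = cnt B s.K := by
          rw [cnt_succ B s.K, if_neg h1, add_zero]
        have := hk s.K (by omega)
        rw [(hupd s.K le_rfl).2] at this
        omega
      have hce := Finset.card_erase_add_one h1
      refine ⟨B.erase (s.K + 1), ⟨?_, by omega, ?_⟩, by simp, Finset.insert_erase h1⟩
      · exact (Finset.erase_subset _ _).trans (sub_Icc_pred hB h2)
      · intro k hk'
        have e := cnt_erase B k h1 (by omega)
        rw [if_neg (by omega)] at e
        have := hk k (by omega)
        rw [(hupd k (by omega)).1, (hupd k (by omega)).2] at this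
        omega
  · rintro (⟨B', ⟨hB, hc, hk⟩, rfl⟩ | ⟨B', ⟨hB, hc, hk⟩, hp, rfl⟩)
    · have h2 : s.K + 2 ∉ B' := notMem_of_sub hB (by omega)
      have hcN := cnt_eq_card B' _ hB
      refine ⟨?_, by rw [Finset.card_insert_of_notMem h2, hc], fun k hk' => ?_⟩
      · exact Finset.insert_subset (by simp) (sub_Icc_succ hB (by omega))
      · have e := cnt_insert B' k h2 (by omega)
        rw [if_neg (by omega)] at e
        rw [e]
        rcases Nat.lt_or_ge k (s.K + 1) with h | h
        · rw [(hupd k (by omega)).1, (hupd k (by omega)).2]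
          exact hk k h
        · have : k = s.K + 1 := by omega
          subst this
          rw [hlast.1, hlast.2]; omega
    · have hcN := cnt_eq_card B' _ hB
      refine ⟨?_, by rw [Finset.card_insert_of_notMem hp, hc], fun k hk' => ?_⟩
      · exact Finset.insert_subset (by simp) (sub_Icc_succ hB (by omega))
      · have e := cnt_insert B' k hp (by omega)
        rcases Nat.lt_or_ge k (s.K + 1) with h | h
        · rw [(hupd k (by omega)).1, (hupd k (by omega)).2]
          rw [if_neg (by omega)] at e
          have := hk k h
          omega
        · have : k = s.K + 1 := by omega
          subst this
          rw [if_pos le_rfl] at e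
          rw [hlast.1, hlast.2]; omega

theorem fam_diag {s : St} (hs : Inv s) :
    famSt (stepSt s .diag) = dsum (famSt s) {{s.K + 2}, {s.K + 3}} := by
  have hupd : ∀ k, k ≤ s.K → (stepSt s .diag).lo k = s.lo k ∧ (stepSt s .diag).hi k = s.hi k := by
    intro k hk
    have : k ≠ s.K + 1 := by omega
    have : k ≠ s.K + 2 := by omega
    simp [stepSt, *]
  have hlast1 : (stepSt s .diag).lo (s.K + 1) = s.c + 1 ∧
      (stepSt s .diag).hi (s.K + 1) = s.c + 1 := by
    simp [stepSt]
  have hlast : (stepSt s .diag).lo (s.K + 2) = s.c + 1 ∧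
      (stepSt s .diag).hi (s.K + 2) = s.c + 2 := by
    simp [stepSt]
  have hloK := hs.loK
  have hhiK := hs.hiK
  ext B
  rw [mem_dsum]
  unfold famSt
  simp only [mem_Fam]
  change (B ⊆ Finset.Icc 1 (s.K + 3) ∧ B.card = s.c + 2 ∧ ∀ k < s.K + 3, _) ↔ _
  constructor
  · rintro ⟨hB, hc, hk⟩
    have hcN := cnt_eq_card B _ hB
    have e1 := hk (s.K + 1) (by omega)
    rw [hlast1.1, hlast1.2] at e1
    have e3 : cnt B (s.K + 3) = cnt B (s.K + 2) + if s.K + 3 ∈ B then 1 else 0 :=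
      cnt_succ B (s.K + 2)
    have e2 : cnt B (s.K + 2) = cnt B (s.K + 1) + if s.K + 2 ∈ B then 1 else 0 :=
      cnt_succ B (s.K + 1)
    have key : ∃ a, (a = s.K + 2 ∨ a = s.K + 3) ∧ a ∈ B ∧ B.erase a ⊆ Finset.Icc 1 (s.K + 1) := by
      by_cases h3 : s.K + 3 ∈ B
      · have h2 : s.K + 2 ∉ B := by
          intro h2
          rw [if_pos h3] at e3
          rw [if_pos h2] at e2
          omega
        refine ⟨s.K + 3, Or.inr rfl, h3, sub_Icc_pred (sub_Icc_pred ?_ (by simp)) (by simp [h2])⟩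
        exact (Finset.erase_subset _ _).trans hB
      · have h2 : s.K + 2 ∈ B := by
          by_contra h2
          rw [if_neg h3] at e3
          rw [if_neg h2] at e2
          omega
        refine ⟨s.K + 2, Or.inl rfl, h2, sub_Icc_pred (sub_Icc_pred ?_ (by simp [h3])) (by simp)⟩
        exact (Finset.erase_subset _ _).trans hB
    obtain ⟨a, ha, haB, hsub⟩ := key
    have hce := Finset.card_erase_add_one haB
    refine ⟨B.erase a, ⟨hsub, by omega, ?_⟩, {a}, ?_, ?_⟩
    · intro k hk'
      have e := cnt_erase B k haB (by omega)
      rw [if_neg (by omega)] at e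
      have := hk k (by omega)
      rw [(hupd k (by omega)).1, (hupd k (by omega)).2] at this
      omega
    · rcases ha with rfl | rfl <;> simp
    · rw [Finset.union_comm, ← Finset.insert_eq, Finset.insert_erase haB]
  · rintro ⟨B0, ⟨hB, hc, hk⟩, B1, hB1, rfl⟩
    have key : ∃ a, (a = s.K + 2 ∨ a = s.K + 3) ∧ B1 = {a} := by
      simp only [Finset.mem_insert, Finset.mem_singleton] at hB1
      rcases hB1 with rfl | rfl
      · exact ⟨_, Or.inl rfl, rfl⟩
      · exact ⟨_, Or.inr rfl, rfl⟩
    obtain ⟨a, ha, rfl⟩ := key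
    rw [Finset.union_comm, ← Finset.insert_eq]
    have h2 : a ∉ B0 := notMem_of_sub hB (by omega)
    have hcN := cnt_eq_card B0 _ hB
    have hcN2 := cnt_eq_card B0 (s.K + 2) (sub_Icc_succ hB (by omega))
    refine ⟨?_, by rw [Finset.card_insert_of_notMem h2, hc], fun k hk' => ?_⟩
    · exact Finset.insert_subset (by simp; omega) (sub_Icc_succ hB (by omega))
    · have e := cnt_insert B0 k h2 (by omega)
      rw [e]
      rcases Nat.lt_or_ge k (s.K + 1) with h | h
      · rw [(hupd k (by omega)).1, (hupd k (by omega)).2, if_neg (by omega)]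
        exact hk k h
      · rcases Nat.lt_or_ge k (s.K + 2) with h' | h'
        · have : k = s.K + 1 := by omega
          subst this
          rw [hlast1.1, hlast1.2, if_neg (by omega)]; omega
        · have : k = s.K + 2 := by omega
          subst this
          rw [hlast.1, hlast.2]
          split_ifs <;> omega

theorem fam_init : famSt initSt = {{1}, {2}} := by
  ext B
  unfold famSt
  simp only [mem_Fam, Finset.mem_insert, Finset.mem_singleton]
  change (B ⊆ Finset.Icc 1 2 ∧ B.card = 1 ∧ ∀ k < 2, 0 ≤ cnt B k ∧
    cnt B k ≤ if k = 0 then 0 else 1) ↔ _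
  constructor
  · rintro ⟨hB, hc, _⟩
    obtain ⟨a, rfl⟩ := Finset.card_eq_one.1 hc
    have := Finset.mem_Icc.1 (hB (Finset.mem_singleton_self a))
    have : a = 1 ∨ a = 2 := by omega
    rcases this with rfl | rfl <;> simp
  · have hk : ∀ B : Finset ℕ, B.card = 1 → ∀ k < 2, 0 ≤ cnt B k ∧
        cnt B k ≤ if k = 0 then 0 else 1 := by
      intro B hB k hk
      refine ⟨Nat.zero_le _, ?_⟩
      split_ifs with h
      · subst h; simp [cnt_zero]
      · rw [← hB]; exact Finset.card_le_card Finset.inter_subset_left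
    rintro (rfl | rfl)
    · exact ⟨by simp, by simp, hk _ (by simp)⟩
    · exact ⟨by simp, by simp, hk _ (by simp)⟩

theorem diagCount_snoc (P : List DStep) (d : DStep) :
    diagCount (P ++ [d]) = diagCount P + if d = .diag then 1 else 0 := by
  unfold diagCount
  rw [List.filter_append, List.length_append]
  cases d <;> simp

theorem struct_st (P : List DStep) : ∃ E0 F0 E1 F1, Finset.Icc 1 ((st P).K + 1) = E0 ∪ E1 ∧
    Disjoint E0 E1 ∧ famSt (st P) = dsum F0 F1 ∧ DS E0 F0 (diagCount P) ∧
    Blk E1 F1 ((st P).K + 1) := by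
  induction P using List.reverseRecOn with
  | nil =>
    refine ⟨∅, {∅}, {1, 2}, {{1}, {2}}, ?_, by simp, ?_, ?_, Blk.base (by norm_num)⟩
    · rfl
    · rw [st_nil, fam_init]; ext B; simp [mem_dsum, eq_comm]
    · exact DS.empty
  | append_singleton P d ih =>
    obtain ⟨E0, F0, E1, F1, hE, hd, hF, hds, hb⟩ := ih
    have hI : Finset.Icc 1 ((st P).K + 2) = insert ((st P).K + 2) (Finset.Icc 1 ((st P).K + 1)) := by
      ext i; simp only [Finset.mem_Icc, Finset.mem_insert]; omega
    have hq : (st P).K + 2 ∉ E0 ∪ E1 := by rw [← hE]; simp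
    have hq0 : (st P).K + 2 ∉ E0 := fun h => hq (Finset.mem_union_left _ h)
    have hq1 : (st P).K + 2 ∉ E1 := fun h => hq (Finset.mem_union_right _ h)
    have hp0 : (st P).K + 1 ∉ E0 := fun h => Finset.disjoint_left.1 hd h hb.mem
    rw [st_snoc, diagCount_snoc]
    cases d with
    | east =>
      refine ⟨E0, F0, insert ((st P).K + 2) E1, parExt F1 ((st P).K + 1) ((st P).K + 2),
        ?_, ?_, ?_, hds, hb.par hq1⟩
      · change Finset.Icc 1 ((st P).K + 2) = _
        rw [hI, hE, Finset.union_insert]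
      · rw [Finset.disjoint_insert_right]; exact ⟨hq0, hd⟩
      · rw [fam_east (inv_st P), hF, parExt_dsum hds.sub hp0]
    | north =>
      refine ⟨E0, F0, insert ((st P).K + 2) E1, serExt F1 ((st P).K + 1) ((st P).K + 2),
        ?_, ?_, ?_, hds, hb.ser hq1⟩
      · change Finset.Icc 1 ((st P).K + 2) = _
        rw [hI, hE, Finset.union_insert]
      · rw [Finset.disjoint_insert_right]; exact ⟨hq0, hd⟩
      · rw [fam_north (inv_st P), hF, serExt_dsum hds.sub hp0]
    | diag =>
      refine ⟨E0 ∪ E1, famSt (st P), {(st P).K + 2, (st P).K + 3},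
        {{(st P).K + 2}, {(st P).K + 3}}, ?_, ?_, fam_diag (inv_st P), ?_,
        Blk.base (by omega)⟩
      · rw [← hE]
        change Finset.Icc 1 ((st P).K + 3) = _
        ext i
        simp only [Finset.mem_Icc, Finset.mem_insert, Finset.mem_union, Finset.mem_singleton]
        omega
      · rw [← hE, Finset.disjoint_left]
        intro i
        simp only [Finset.mem_Icc, Finset.mem_insert, Finset.mem_singleton]
        omega
      · rw [hF]; exact hds.add hb hd

theorem ds_st (P : List DStep) :
    DS (Finset.Icc 1 ((st P).K + 1)) (famSt (st P)) (diagCount P + 1) := by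
  obtain ⟨E0, F0, E1, F1, hE, hd, hF, hds, hb⟩ := struct_st P
  rw [hE, hF]
  exact hds.add hb hd

/-! ### Cells of paths -/

/-- `Y` satisfies all the strict bounds of the state -/
def Bnd (s : St) (Y : ℕ → ℝ) : Prop :=
  ∀ k ≤ s.K, (s.lo k < s.hi k → (s.lo k : ℝ) < Y k ∧ Y k < s.hi k) ∧
    (s.lo k = s.hi k → Y k = s.lo k)

/-- the additional condition imposed by a step -/
def stepCond (s : St) (Y : ℕ → ℝ) : DStep → Prop
  | .east => (s.c : ℝ) < Y (s.K + 1) ∧ Y (s.K + 1) < s.c + 1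
  | .north => (s.c : ℝ) + 1 < Y (s.K + 1) ∧ Y (s.K + 1) < s.c + 2
  | .diag => Y (s.K + 1) = s.c + 1 ∧ (s.c : ℝ) + 1 < Y (s.K + 2) ∧ Y (s.K + 2) < s.c + 2

theorem bnd_init (Y : ℕ → ℝ) : Bnd initSt Y ↔ Y 0 = 0 ∧ 0 < Y 1 ∧ Y 1 < 1 := by
  unfold Bnd
  constructor
  · intro h
    have h0 := (h 0 (by simp [initSt])).2 (by simp [initSt])
    have h1 := (h 1 (by simp [initSt])).1 (by simp [initSt])
    simp [initSt] at h0 h1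
    exact ⟨h0, h1⟩
  · rintro ⟨h0, h1⟩ k hk
    have : k = 0 ∨ k = 1 := by simp [initSt] at hk; omega
    rcases this with rfl | rfl
    · simp [initSt, h0]
    · simp [initSt, h1]

theorem bnd_step (s : St) (d : DStep) (Y : ℕ → ℝ) :
    Bnd (stepSt s d) Y ↔ Bnd s Y ∧ stepCond s Y d := by
  have hupd : ∀ k ≤ s.K, (stepSt s d).lo k = s.lo k ∧ (stepSt s d).hi k = s.hi k := by
    intro k hk
    have : k ≠ s.K + 1 := by omega
    have : k ≠ s.K + 2 := by omega
    cases d <;> simp [stepSt, *]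
  have hKle : s.K + 1 ≤ (stepSt s d).K := by cases d <;> simp [stepSt]
  have e1 : Bnd (stepSt s d) Y → Bnd s Y := by
    intro h k hk
    have := h k (by omega)
    rwa [(hupd k hk).1, (hupd k hk).2] at this
  unfold Bnd
  constructor
  · intro h
    refine ⟨e1 h, ?_⟩
    cases d
    · have := (h (s.K + 1) hKle).1 (by simp [stepSt])
      simpa [stepSt, stepCond] using this
    · have := (h (s.K + 1) hKle).1 (by simp [stepSt])
      simpa [stepSt, stepCond] using this
    · have h1 := (h (s.K + 1) hKle).2 (by simp [stepSt])
      have h2 := (h (s.K + 2) (by simp [stepSt])).1 (by simp [stepSt])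
      simp [stepSt] at h1 h2
      exact ⟨h1, h2⟩
  · rintro ⟨h, hc⟩ k hk
    rcases Nat.lt_or_ge s.K k with hlt | hge
    · cases d
      · have : k = s.K + 1 := by simp [stepSt] at hk; omega
        subst this
        simpa [stepSt, stepCond] using hc
      · have : k = s.K + 1 := by simp [stepSt] at hk; omega
        subst this
        simpa [stepSt, stepCond] using hc
      · have : k = s.K + 1 ∨ k = s.K + 2 := by simp [stepSt] at hk; omega
        obtain ⟨hc1, hc2⟩ := hc
        rcases this with rfl | rfl
        · simp [stepSt, hc1]
        · simp [stepSt, hc2]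
    · rw [(hupd k hge).1, (hupd k hge).2]
      exact h k hge

theorem bnd_last {s : St} (hs : Inv s) {Y : ℕ → ℝ} (h : Bnd s Y) :
    (s.c : ℝ) < Y s.K ∧ Y s.K < s.c + 1 := by
  have := (h s.K le_rfl).1 (by rw [hs.loK, hs.hiK]; omega)
  rw [hs.loK, hs.hiK] at this
  simpa using this

theorem bnd_congr {s : St} {Y Z : ℕ → ℝ} (h : ∀ k ≤ s.K, Y k = Z k) (hY : Bnd s Y) : Bnd s Z := by
  intro k hk
  rw [← h k hk]
  exact hY k hk

theorem slater_st (P : List DStep) : ∃ Y : ℕ → ℝ, Bnd (st P) Y ∧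
    (∀ k ≤ (st P).K, 0 < Y (k + 1) - Y k ∧ Y (k + 1) - Y k < 1) ∧
    Y ((st P).K + 1) = (st P).c + 1 := by
  induction P using List.reverseRecOn with
  | nil =>
    refine ⟨fun k => k / 2, ?_, ?_, ?_⟩
    · rw [st_nil, bnd_init]; norm_num
    · intro k _; push_cast; constructor <;> linarith
    · simp [st_nil, initSt]
  | append_singleton P d ih =>
    obtain ⟨Y, hY, hinc, _⟩ := ih
    have hl := bnd_last (inv_st P) hY
    rw [st_snoc]
    set s := st P with hs
    clear_value s
    cases d with
    | east =>
      refine ⟨fun k => if k ≤ s.K then Y k else if k = s.K + 1 then (Y s.K + (s.c + 1)) / 2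
        else s.c + 1, ?_, ?_, ?_⟩
      · rw [bnd_step]
        refine ⟨bnd_congr (fun k hk => by simp [hk]) hY, ?_⟩
        simp only [stepCond]
        rw [if_neg (by omega), if_pos trivial]
        constructor <;> linarith
      · intro k hk
        have hk' : k ≤ s.K + 1 := hk
        rcases Nat.lt_or_ge k s.K with h | h
        · have := hinc k h.le
          simp only [if_pos h.le, if_pos (show k + 1 ≤ s.K by omega)]
          exact this
        · rcases Nat.lt_or_ge k (s.K + 1) with h' | h'
          · obtain rfl : k = s.K := by omega
            simp
            constructor <;> linarith
          · obtain rfl : k = s.K + 1 := by omega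
            simp
            constructor <;> linarith
      · simp [stepSt]
    | north =>
      refine ⟨fun k => if k ≤ s.K then Y k else if k = s.K + 1 then (Y s.K + 1 + (s.c + 1)) / 2
        else s.c + 2, ?_, ?_, ?_⟩
      · rw [bnd_step]
        refine ⟨bnd_congr (fun k hk => by simp [hk]) hY, ?_⟩
        simp only [stepCond]
        rw [if_neg (by omega), if_pos trivial]
        constructor <;> linarith
      · intro k hk
        have hk' : k ≤ s.K + 1 := hk
        rcases Nat.lt_or_ge k s.K with h | h
        · have := hinc k h.le
          simp only [if_pos h.le, if_pos (show k + 1 ≤ s.K by omega)]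
          exact this
        · rcases Nat.lt_or_ge k (s.K + 1) with h' | h'
          · obtain rfl : k = s.K := by omega
            simp
            constructor <;> linarith
          · obtain rfl : k = s.K + 1 := by omega
            simp
            constructor <;> linarith
      · simp [stepSt]; ring
    | diag =>
      refine ⟨fun k => if k ≤ s.K then Y k else if k = s.K + 1 then s.c + 1
        else if k = s.K + 2 then s.c + 3 / 2 else s.c + 2, ?_, ?_, ?_⟩
      · rw [bnd_step]
        refine ⟨bnd_congr (fun k hk => by simp [hk]) hY, ?_⟩
        simp only [stepCond]
        rw [if_neg (by omega), if_pos trivial, if_neg (by omega), if_neg (by omega), if_pos trivial]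
        refine ⟨rfl, ?_, ?_⟩ <;> linarith
      · intro k hk
        have hk' : k ≤ s.K + 2 := hk
        rcases Nat.lt_or_ge k s.K with h | h
        · have := hinc k h.le
          simp only [if_pos h.le, if_pos (show k + 1 ≤ s.K by omega)]
          exact this
        · rcases Nat.lt_or_ge k (s.K + 1) with h' | h'
          · obtain rfl : k = s.K := by omega
            simp
            constructor <;> linarith
          · rcases Nat.lt_or_ge k (s.K + 2) with h'' | h''
            · obtain rfl : k = s.K + 1 := by omega
              simp
              constructor <;> linarith
            · obtain rfl : k = s.K + 2 := by omega
              simp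
              constructor <;> linarith
      · simp [stepSt]; ring

theorem st_unique (P : List DStep) : ∀ (Q : List DStep) (Y : ℕ → ℝ), (st P).K = (st Q).K →
    (st P).c = (st Q).c → Bnd (st P) Y → Bnd (st Q) Y → P = Q := by
  induction P using List.reverseRecOn with
  | nil =>
    intro Q Y hK _ _ _
    induction Q using List.reverseRecOn with
    | nil => rfl
    | append_singleton Q e _ =>
      exfalso
      have := (inv_st Q).K1
      rw [st_snoc, st_nil] at hK
      cases e <;> simp [stepSt, initSt] at hK <;> omega
  | append_singleton P d ih =>
    intro Q Y hK hc hP hQ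
    induction Q using List.reverseRecOn with
    | nil =>
      exfalso
      have := (inv_st P).K1
      rw [st_snoc, st_nil] at hK
      cases d <;> simp [stepSt, initSt] at hK <;> omega
    | append_singleton Q e _ =>
      rw [st_snoc] at hK hc hP hQ
      rw [st_snoc] at hK hc
      rw [bnd_step] at hP hQ
      obtain ⟨hP1, hP2⟩ := hP
      obtain ⟨hQ1, hQ2⟩ := hQ
      have lP := bnd_last (inv_st P) hP1
      have lQ := bnd_last (inv_st Q) hQ1
      have ih' := ih Q Y
      generalize hsP : st P = s at *
      generalize hsQ : st Q = t at *
      obtain ⟨K, c, lo, hi⟩ := s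
      obtain ⟨K', c', lo', hi'⟩ := t
      cases d <;> cases e <;> simp only [stepSt, stepCond] at hK hc hP2 hQ2 lP lQ ih'
      · rw [ih' (by omega) (by omega) hP1 hQ1]
      · exfalso
        obtain rfl : K = K' := by omega
        subst hc
        push_cast at *
        linarith
      · exfalso
        obtain rfl : K = K' + 1 := by omega
        subst hc
        push_cast at *
        linarith
      · exfalso
        obtain rfl : K = K' := by omega
        subst hc
        push_cast at *
        linarith
      · rw [ih' (by omega) (by omega) hP1 hQ1]
      · exfalso
        obtain rfl : K = K' + 1 := by omega
        obtain rfl : c = c' := by omega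
        linarith
      · exfalso
        obtain rfl : K' = K + 1 := by omega
        subst hc
        push_cast at *
        linarith
      · exfalso
        obtain rfl : K' = K + 1 := by omega
        obtain rfl : c = c' := by omega
        linarith
      · rw [ih' (by omega) (by omega) hP1 hQ1]

theorem st_exists (Y : ℕ → ℝ) (h0 : Y 0 = 0) : ∀ (k c : ℕ), 1 ≤ k →
    (∀ j < k, 0 < Y (j + 1) - Y j ∧ Y (j + 1) - Y j < 1) → (c : ℝ) < Y k → Y k < c + 1 →
    ∃ P, (st P).K = k ∧ (st P).c = c ∧ Bnd (st P) Y := by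
  intro k
  induction k using Nat.strong_induction_on with
  | _ k ih =>
    intro c hk hinc hc1 hc2
    have hpos : ∀ j, j < k → 0 < Y (j + 1) := by
      intro j
      induction j with
      | zero => intro hj; have := hinc 0 hj; rw [h0] at this; linarith [this.1]
      | succ j ihj => intro hj; have := ihj (by omega); have := hinc (j + 1) hj; linarith [this.1]
    obtain ⟨k', rfl⟩ : ∃ k', k = k' + 1 := ⟨k - 1, by omega⟩
    rcases Nat.eq_zero_or_pos k' with rfl | hk'
    · have hi := hinc 0 (by omega)
      rw [h0] at hi
      simp only [zero_add, sub_zero] at hi hc1 hc2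
      have : c = 0 := by
        have : (c : ℝ) < 1 := by linarith
        have : c < 1 := by exact_mod_cast this
        omega
      subst this
      exact ⟨[], rfl, rfl, by rw [st_nil, bnd_init]; exact ⟨h0, hi.1, hi.2⟩⟩
    · obtain ⟨k'', rfl⟩ : ∃ k'', k' = k'' + 1 := ⟨k' - 1, by omega⟩
      have hp := hpos k'' (by omega)
      have hi := hinc (k'' + 1) (by omega)
      rcases lt_trichotomy (c : ℝ) (Y (k'' + 1)) with h | h | h
      · obtain ⟨P, hK, hc, hB⟩ := ih (k'' + 1) (by omega) c (by omega)
          (fun j hj => hinc j (by omega)) h (by linarith)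
        refine ⟨P ++ [.east], ?_, ?_, ?_⟩
        · rw [st_snoc]; simp [stepSt, hK]
        · rw [st_snoc]; simp [stepSt, hc]
        · rw [st_snoc, bnd_step]
          refine ⟨hB, ?_⟩
          simp only [stepCond, hK, hc]
          exact ⟨hc1, hc2⟩
      · have hc0 : c ≠ 0 := by rintro rfl; simp at h; linarith
        obtain ⟨c', rfl⟩ : ∃ c', c = c' + 1 := ⟨c - 1, by omega⟩
        have hi2 := hinc k'' (by omega)
        push_cast at *
        have hk1 : 1 ≤ k'' := by
          by_contra hlt
          obtain rfl : k'' = 0 := by omega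
          rw [h0] at hi2
          have : (0 : ℝ) ≤ c' := Nat.cast_nonneg _
          linarith [hi2.2]
        obtain ⟨P, hK, hc, hB⟩ := ih k'' (by omega) c' hk1
          (fun j hj => hinc j (by omega)) (by linarith) (by linarith)
        refine ⟨P ++ [.diag], ?_, ?_, ?_⟩
        · rw [st_snoc]; simp [stepSt, hK]
        · rw [st_snoc]; simp [stepSt, hc]
        · rw [st_snoc, bnd_step]
          refine ⟨hB, ?_⟩
          simp only [stepCond, hK, hc]
          exact ⟨h.symm, hc1, by linarith⟩
      · have hc0 : c ≠ 0 := by rintro rfl; simp at h; linarith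
        obtain ⟨c', rfl⟩ : ∃ c', c = c' + 1 := ⟨c - 1, by omega⟩
        push_cast at *
        obtain ⟨P, hK, hc, hB⟩ := ih (k'' + 1) (by omega) c' (by omega)
          (fun j hj => hinc j (by omega)) (by linarith) (by linarith)
        refine ⟨P ++ [.north], ?_, ?_, ?_⟩
        · rw [st_snoc]; simp [stepSt, hK]
        · rw [st_snoc]; simp [stepSt, hc]
        · rw [st_snoc, bnd_step]
          refine ⟨hB, ?_⟩
          simp only [stepCond, hK, hc]
          exact ⟨hc1, by linarith⟩

/-! ### Admissibility -/

/-- the strict upper bound by `path(U)` -/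
def Low (U : Finset ℕ) (s : St) : Prop := ∀ k, 1 ≤ k → k ≤ s.K → s.lo k < cnt U k

theorem low_step (U : Finset ℕ) {s : St} (hs : Inv s) (d : DStep) :
    Low U (stepSt s d) ↔ Low U s ∧ (d ≠ .east → s.c + 1 < cnt U (s.K + 1)) := by
  have hupd : ∀ k ≤ s.K, (stepSt s d).lo k = s.lo k := by
    intro k hk
    have : k ≠ s.K + 1 := by omega
    have : k ≠ s.K + 2 := by omega
    cases d <;> simp [stepSt, *]
  have hKle : s.K + 1 ≤ (stepSt s d).K := by cases d <;> simp [stepSt]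
  constructor
  · intro h
    refine ⟨fun k h1 hk => ?_, ?_⟩
    · have := h k h1 (by omega)
      rwa [hupd k hk] at this
    · intro hd
      have := h (s.K + 1) (by omega) hKle
      cases d
      · exact absurd rfl hd
      · simpa [stepSt] using this
      · simpa [stepSt] using this
  · rintro ⟨h, hc⟩ k h1 hk
    have hl := h s.K hs.K1 le_rfl
    rw [hs.loK] at hl
    have m1 := cnt_mono U (show s.K ≤ s.K + 1 by omega)
    have m2 := cnt_mono U (show s.K + 1 ≤ s.K + 2 by omega)
    rcases Nat.lt_or_ge s.K k with hlt | hge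
    · cases d
      · obtain rfl : k = s.K + 1 := by simp [stepSt] at hk; omega
        simp [stepSt]; omega
      · obtain rfl : k = s.K + 1 := by simp [stepSt] at hk; omega
        simpa [stepSt] using hc (by simp)
      · have hc' := hc (by simp)
        have : k = s.K + 1 ∨ k = s.K + 2 := by simp [stepSt] at hk; omega
        rcases this with rfl | rfl
        · simpa [stepSt] using hc'
        · simp [stepSt]; omega
    · rw [hupd k hge]
      exact h k h1 hge

/-- local admissibility -/
def Adm (U : Finset ℕ) (P : List DStep) : Prop :=
  (∀ k ≤ P.length, belowPath U (pathPos (1, 1) P k)) ∧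
    ∀ (k : ℕ) (h : k < P.length),
      (P.get ⟨k, h⟩ = DStep.north →
          ¬ uVertSeg U (pathPos (1, 1) P k).1 (pathPos (1, 1) P k).2) ∧
      (P.get ⟨k, h⟩ = DStep.diag →
        belowPath U ((pathPos (1, 1) P k).1, (pathPos (1, 1) P k).2 + 1) ∧
          ¬ uVertSeg U (pathPos (1, 1) P k).1 (pathPos (1, 1) P k).2)

theorem pathPos_app (P : List DStep) (d : DStep) {k : ℕ} (hk : k ≤ P.length) :
    pathPos (1, 1) (P ++ [d]) k = pathPos (1, 1) P k := by
  unfold pathPos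
  rw [List.take_append_of_le_length hk]

theorem pathPos_end (P : List DStep) (d : DStep) :
    pathPos (1, 1) (P ++ [d]) (P.length + 1) =
      ((pathPos (1, 1) P P.length).1 + d.dx, (pathPos (1, 1) P P.length).2 + d.dy) := by
  unfold pathPos
  rw [List.take_of_length_le (by simp), List.take_of_length_le (by simp)]
  simp [add_assoc]

theorem adm_snoc (U : Finset ℕ) (P : List DStep) (d : DStep) :
    Adm U (P ++ [d]) ↔ Adm U P ∧
      belowPath U ((pathPos (1, 1) P P.length).1 + d.dx, (pathPos (1, 1) P P.length).2 + d.dy) ∧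
      (d = .north → ¬ uVertSeg U (pathPos (1, 1) P P.length).1 (pathPos (1, 1) P P.length).2) ∧
      (d = .diag → belowPath U ((pathPos (1, 1) P P.length).1, (pathPos (1, 1) P P.length).2 + 1) ∧
        ¬ uVertSeg U (pathPos (1, 1) P P.length).1 (pathPos (1, 1) P P.length).2) := by
  have hlen : (P ++ [d]).length = P.length + 1 := by simp
  constructor
  · rintro ⟨h1, h2⟩
    refine ⟨⟨fun k hk => ?_, fun k hk => ?_⟩, ?_, ?_⟩
    · have := h1 k (by omega)
      rwa [pathPos_app P d hk] at this
    · have := h2 k (by omega)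
      rw [pathPos_app P d hk.le] at this
      simpa [List.getElem_append_left, hk] using this
    · have := h1 (P.length + 1) (by omega)
      rwa [pathPos_end] at this
    · have := h2 P.length (by omega)
      rw [pathPos_app P d le_rfl] at this
      simpa using this
  · rintro ⟨⟨h1, h2⟩, h3, h4⟩
    refine ⟨fun k hk => ?_, fun k hk => ?_⟩
    · rcases Nat.lt_or_ge P.length k with h | h
      · obtain rfl : k = P.length + 1 := by omega
        rwa [pathPos_end]
      · rw [pathPos_app P d h]; exact h1 k h
    · rcases Nat.lt_or_ge k P.length with h | h
      · rw [pathPos_app P d h.le]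
        simpa [List.getElem_append_left, h] using h2 k h
      · obtain rfl : k = P.length := by omega
        rw [pathPos_app P d le_rfl]
        simpa using h4

theorem pos_st (P : List DStep) :
    (pathPos (1, 1) P P.length).1 + (pathPos (1, 1) P P.length).2 = (st P).K + 1 ∧
    (pathPos (1, 1) P P.length).2 = (st P).c + 1 ∧ 1 ≤ (pathPos (1, 1) P P.length).1 := by
  induction P using List.reverseRecOn with
  | nil => simp [pathPos, st_nil, initSt]
  | append_singleton P d ih =>
    obtain ⟨h1, h2, h3⟩ := ih
    rw [List.length_append, List.length_singleton, pathPos_end, st_snoc]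
    cases d <;> simp only [DStep.dx, DStep.dy, stepSt] <;> omega

theorem adm_iff (U : Finset ℕ) (hU : 1 ∈ U) (P : List DStep) : Adm U P ↔ Low U (st P) := by
  have hc1 : cnt U 1 = 1 := by
    have := cnt_succ U 0
    rw [if_pos (by simpa using hU), cnt_zero] at this
    simpa using this
  induction P using List.reverseRecOn with
  | nil =>
    refine ⟨fun _ k h1 hk => ?_, fun _ => ⟨fun k hk => ?_, fun k hk => ?_⟩⟩
    · obtain rfl : k = 1 := by simp [st_nil, initSt] at hk; omega
      simp [st_nil, initSt, hc1]
    · change 1 + _ ≤ cnt U _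
      have := cnt_mono U (show 1 ≤ 2 by omega)
      simp [pathPos]
      omega
    · simp at hk
  | append_singleton P d ih =>
    have ih2 : Adm U P ↔ Low U (st P) := ih
    rw [adm_snoc, ih2, st_snoc, low_step U (inv_st P)]
    refine and_congr_right fun hlow => ?_
    obtain ⟨e1, e2, e3⟩ := pos_st P
    have hl := hlow (st P).K (inv_st P).K1 le_rfl
    rw [(inv_st P).loK] at hl
    generalize pathPos (1, 1) P P.length = p at *
    obtain ⟨X, Y⟩ := p
    simp only at e1 e2 e3 ⊢
    have m1 := cnt_mono U (show (st P).K ≤ (st P).K + 1 by omega)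
    have m2 := cnt_mono U (show (st P).K + 1 ≤ (st P).K + 2 by omega)
    have m3 := cnt_mono U (show (st P).K + 2 ≤ (st P).K + 3 by omega)
    have m4 : cnt U ((st P).K + 2) = cnt U ((st P).K + 1) + if (st P).K + 2 ∈ U then 1 else 0 :=
      cnt_succ U _
    have hu : uVertSeg U X Y ↔ (st P).K + 2 ∈ U ∧ cnt U ((st P).K + 2) = (st P).c + 2 := by
      unfold uVertSeg
      rw [show X + Y + 1 = (st P).K + 2 by omega, e2]
      rfl
    have hb : ∀ a b, belowPath U (a, b) ↔ b ≤ cnt U (a + b) := fun a b => Iff.rfl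
    rw [hu]
    simp only [hb]
    cases d with
    | east =>
      simp only [DStep.dx, DStep.dy, ne_eq, not_true_eq_false, reduceCtorEq, false_imp_iff,
        and_true, iff_true, add_zero]
      rw [show X + 1 + Y = (st P).K + 2 by omega]
      omega
    | north =>
      simp only [DStep.dx, DStep.dy, ne_eq, reduceCtorEq, not_false_eq_true, true_imp_iff,
        false_imp_iff, and_true, add_zero]
      rw [show X + (Y + 1) = (st P).K + 2 by omega]
      split_ifs at m4 with h
      · simp only [h, true_and]; omega
      · simp only [h, false_and, not_false_eq_true, and_true]; omega
    | diag =>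
      simp only [DStep.dx, DStep.dy, ne_eq, reduceCtorEq, not_false_eq_true, true_imp_iff,
        false_imp_iff, true_and]
      rw [show X + (Y + 1) = (st P).K + 2 by omega, show X + 1 + (Y + 1) = (st P).K + 3 by omega]
      split_ifs at m4 with h
      · simp only [h, true_and]; omega
      · simp only [h, false_and, not_false_eq_true, and_true]; omega

theorem admissible_iff (n r : ℕ) (U : Finset ℕ) (hU : 1 ∈ U) (hn : n ∉ U) (hr : r ≤ n)
    (P : List DStep) :
    IsAdmissible n r U P ↔ (st P).K + 1 = n ∧ (st P).c + 1 = r ∧ Low U (st P) := by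
  rw [← adm_iff U hU]
  obtain ⟨e1, e2, e3⟩ := pos_st P
  have hend : pathPos (1, 1) P P.length = (n - r, r) ↔ (st P).K + 1 = n ∧ (st P).c + 1 = r := by
    rw [Prod.ext_iff]
    simp only
    omega
  unfold IsAdmissible IsDelannoy
  rw [hend]
  constructor
  · rintro ⟨⟨h1, h2⟩, h3⟩
    refine ⟨h1.1, h1.2, h2, fun k hk => ⟨fun hN => ?_, (h3 k hk).2⟩⟩
    rcases (h3 k hk).1 hN with h | h
    · rintro ⟨hu, _⟩
      apply hn
      have hsum : (pathPos (1, 1) P (k + 1)).1 = (pathPos (1, 1) P k).1 ∧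
          (pathPos (1, 1) P (k + 1)).2 = (pathPos (1, 1) P k).2 + 1 := by
        simp only [List.get_eq_getElem] at hN
        unfold pathPos
        rw [List.take_add_one, List.getElem?_eq_getElem hk, hN]
        simp [DStep.dx, DStep.dy]
        omega
      rw [h] at hsum
      simp only at hsum
      rwa [show n = (pathPos (1, 1) P k).1 + (pathPos (1, 1) P k).2 + 1 by omega]
    · exact h
  · rintro ⟨h1, h2, h3, h4⟩
    exact ⟨⟨⟨h1, h2⟩, h3⟩, fun k hk => ⟨fun hN => Or.inr ((h4 k hk).1 hN), (h4 k hk).2⟩⟩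

/-! ### Assembling the decomposition -/

theorem scell_iff (s : St) (x : ↑(Finset.Icc 1 (s.K + 1)) → ℝ) :
    SCell (s.K + 1) (s.c + 1) s.lo s.hi x ↔ (∀ e, 0 < x e ∧ x e < 1) ∧
      psum (s.K + 1) (s.K + 1) x = s.c + 1 ∧ Bnd s (fun k => psum (s.K + 1) k x) := by
  unfold SCell Bnd
  push_cast
  simp only [Nat.lt_succ_iff]

theorem relint_st (P : List DStep) (x : ↑(Finset.Icc 1 ((st P).K + 1)) → ℝ) :
    x ∈ intrinsicInterior ℝ (basePolytope (Finset.Icc 1 ((st P).K + 1)) (famSt (st P))) ↔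
      SCell ((st P).K + 1) ((st P).c + 1) (st P).lo (st P).hi x := by
  obtain ⟨Y, hY, hinc, hlast⟩ := slater_st P
  have hi := inv_st P
  have h0 : Y 0 = 0 := by
    have := (hY 0 (Nat.zero_le _)).2 (by rw [hi.lo0, hi.hi0])
    rw [this, hi.lo0]; simp
  refine relint_Fam _ _ _ _ (fun k _ => hi.le k) (xOf _ Y) ?_ x
  rw [scell_iff]
  refine ⟨?_, ?_, ?_⟩
  · rintro ⟨e, he⟩
    have h1 := Finset.mem_Icc.1 he
    obtain ⟨k, rfl⟩ : ∃ k, e = k + 1 := ⟨e - 1, by omega⟩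
    exact hinc k (by omega)
  · rw [psum_xOf _ Y h0 _ le_rfl, hlast]
  · exact bnd_congr (fun k hk => (psum_xOf _ Y h0 k (by omega)).symm) hY

theorem cnt_add_le (U : Finset ℕ) (k j : ℕ) : cnt U (k + j) ≤ cnt U k + j := by
  induction j with
  | zero => simp
  | succ j ih =>
    have := cnt_succ U (k + j)
    rw [← add_assoc, this]
    split_ifs <;> omega

theorem psum_inc (n : ℕ) (x : ↑(Finset.Icc 1 n) → ℝ) (hx : ∀ e, 0 < x e ∧ x e < 1) (k : ℕ)
    (hk : k < n) : 0 < psum n (k + 1) x - psum n k x ∧ psum n (k + 1) x - psum n k x < 1 := by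
  rw [psum_succ n k x hk]
  have := hx ⟨k + 1, Finset.mem_Icc.2 ⟨by omega, hk⟩⟩
  constructor <;> linarith [this.1, this.2]

theorem psum_pos (n : ℕ) (x : ↑(Finset.Icc 1 n) → ℝ) (hx : ∀ e, 0 < x e ∧ x e < 1) (k : ℕ)
    (hk : k < n) : 0 < psum n (k + 1) x := by
  induction k with
  | zero =>
    have := (psum_inc n x hx 0 hk).1
    rw [psum_zero] at this
    linarith
  | succ k ih =>
    have := (psum_inc n x hx (k + 1) hk).1
    have := ih (by omega)
    linarith

theorem slater_schubert (n r : ℕ) (U : Finset ℕ) (hU : U ⊆ Finset.Icc 1 n) (hr : U.card = r)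
    (h1 : 1 ∈ U) (hn : n ∉ U) (hr1 : 1 ≤ r) (hrn : r < n) :
    ∃ x, SCell n r (fun _ => 0) (cnt U) x := by
  have hc1 : cnt U 1 = 1 := by
    have := cnt_succ U 0
    rw [if_pos (by simpa using h1), cnt_zero] at this
    simpa using this
  have hcn : cnt U (n - 1) = r := by
    rw [← hr]
    refine cnt_eq_card U _ (sub_Icc_pred ?_ ?_)
    · rwa [show n - 1 + 1 = n by omega]
    · rwa [show n - 1 + 1 = n by omega]
  obtain ⟨d, rfl⟩ : ∃ d, n = d + r := ⟨n - r, by omega⟩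
  have hd : 1 ≤ d := by omega
  have hdR : (1 : ℝ) ≤ d := by exact_mod_cast hd
  have hrR : (1 : ℝ) ≤ r := by exact_mod_cast hr1
  obtain ⟨a, ha, ha0, ha1⟩ : ∃ a : ℝ, (d : ℝ) * a = 1 / 2 ∧ 0 < a ∧ a < 1 := by
    refine ⟨1 / (2 * d), by field_simp, by positivity, ?_⟩
    rw [div_lt_one (by positivity)]; linarith
  obtain ⟨b, hb, hb0, hb1⟩ : ∃ b : ℝ, (r : ℝ) * b = 1 / 2 ∧ 0 < b ∧ b < 1 := by
    refine ⟨1 / (2 * r), by field_simp, by positivity, ?_⟩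
    rw [div_lt_one (by positivity)]; linarith
  set Y : ℕ → ℝ := fun k => if k ≤ d then k * a else 1 / 2 + ((k : ℝ) - d) * (1 - b) with hY
  have hYlo : ∀ k, k ≤ d → Y k = k * a := fun k hk => by simp [hY, hk]
  have hYhi : ∀ k, d ≤ k → Y k = 1 / 2 + ((k : ℝ) - d) * (1 - b) := by
    intro k hk
    rcases Nat.lt_or_ge d k with h | h
    · simp [hY, Nat.not_le.2 h]
    · obtain rfl : k = d := by omega
      rw [hYlo _ le_rfl, ha]; simp
  have hY0 : Y 0 = 0 := by rw [hYlo 0 (by omega)]; simp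
  have hinc : ∀ k, 0 < Y (k + 1) - Y k ∧ Y (k + 1) - Y k < 1 := by
    intro k
    rcases Nat.lt_or_ge k d with h | h
    · rw [hYlo k h.le, hYlo (k + 1) h]
      push_cast
      constructor <;> nlinarith
    · rw [hYhi k h, hYhi (k + 1) (by omega)]
      push_cast
      constructor <;> nlinarith
  refine ⟨xOf _ Y, ?_, ?_, ?_⟩
  · rintro ⟨e, he⟩
    have h1 := Finset.mem_Icc.1 he
    obtain ⟨k, rfl⟩ : ∃ k, e = k + 1 := ⟨e - 1, by omega⟩
    exact hinc k
  · rw [psum_xOf _ Y hY0 _ le_rfl, hYhi _ (by omega)]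
    push_cast
    linarith
  · intro k hk
    rw [psum_xOf _ Y hY0 k hk.le]
    rcases Nat.eq_zero_or_pos k with rfl | hk0
    · simp [cnt_zero, hY0]
    · have g1 : 1 ≤ cnt U k := by rw [← hc1]; exact cnt_mono U hk0
      refine ⟨fun _ => ?_, fun h => by beta_reduce at h; omega⟩
      have g2 := cnt_add_le U k (d + r - 1 - k)
      rw [show k + (d + r - 1 - k) = d + r - 1 by omega, hcn] at g2
      have hkR : (1 : ℝ) ≤ k := by exact_mod_cast hk0
      have g1R : (1 : ℝ) ≤ cnt U k := by exact_mod_cast g1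
      rcases Nat.lt_or_ge k d with h | h
      · rw [hYlo k h.le]
        have : (k : ℝ) ≤ d := by exact_mod_cast h.le
        simp only [Nat.cast_zero]
        constructor <;> nlinarith
      · rw [hYhi k h]
        have hR : (d : ℝ) ≤ k := by exact_mod_cast h
        have hR2 : (k : ℝ) < d + r := by exact_mod_cast hk
        have g3 : k + 1 ≤ cnt U k + d := by omega
        have g3R : (k : ℝ) + 1 ≤ cnt U k + d := by exact_mod_cast g3
        simp only [Nat.cast_zero]
        constructor <;> nlinarith

instance : Fintype DStep := ⟨{.east, .north, .diag}, fun x => by cases x <;> simp⟩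

theorem length_le_st (P : List DStep) : P.length ≤ (st P).K := by
  induction P using List.reverseRecOn with
  | nil => simp
  | append_singleton P d ih =>
    rw [List.length_append, List.length_singleton, st_snoc]
    cases d <;> simp only [stepSt] <;> omega

theorem scell_mono (n r : ℕ) (U : Finset ℕ) (h1 : 1 ∈ U) (P : List DStep)
    (hK : (st P).K + 1 = n) (hc : (st P).c + 1 = r) (hlow : Low U (st P))
    (x : ↑(Finset.Icc 1 n) → ℝ) (hx : SCell n r (st P).lo (st P).hi x) :
    SCell n r (fun _ => 0) (cnt U) x := by
  refine ⟨hx.1, hx.2.1, fun k hk => ?_⟩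
  rcases Nat.eq_zero_or_pos k with rfl | hk0
  · simp [cnt_zero, psum_zero]
  · have hl := hlow k hk0 (by omega)
    refine ⟨fun _ => ?_, fun h => by beta_reduce at h; omega⟩
    obtain ⟨k', rfl⟩ : ∃ k', k = k' + 1 := ⟨k - 1, by omega⟩
    refine ⟨by simpa using psum_pos n x hx.1 k' (by omega), ?_⟩
    have hlR : ((st P).lo (k' + 1) : ℝ) + 1 ≤ cnt U (k' + 1) := by exact_mod_cast hl
    obtain ⟨g1, g2⟩ := hx.2.2 (k' + 1) hk
    rcases Nat.lt_or_ge ((st P).lo (k' + 1)) ((st P).hi (k' + 1)) with h | h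
    · have := (g1 h).2
      have h3 : ((st P).hi (k' + 1) : ℝ) ≤ (st P).lo (k' + 1) + 1 := by
        exact_mod_cast (inv_st P).le1 (k' + 1)
      linarith
    · have := g2 (le_antisymm ((inv_st P).le _) h)
      linarith

theorem scell_exists (n r : ℕ) (U : Finset ℕ) (h1 : 1 ∈ U) (hr1 : 1 ≤ r) (hrn : r < n)
    (x : ↑(Finset.Icc 1 n) → ℝ) (hx : SCell n r (fun _ => 0) (cnt U) x) :
    ∃ P, (st P).K + 1 = n ∧ (st P).c + 1 = r ∧ Low U (st P) ∧
      SCell n r (st P).lo (st P).hi x := by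
  have hc1 : cnt U 1 = 1 := by
    have := cnt_succ U 0
    rw [if_pos (by simpa using h1), cnt_zero] at this
    simpa using this
  obtain ⟨N, rfl⟩ : ∃ N, n = N + 1 := ⟨n - 1, by omega⟩
  obtain ⟨c, rfl⟩ : ∃ c, r = c + 1 := ⟨r - 1, by omega⟩
  have hlast := psum_inc _ x hx.1 N (by omega)
  have hsum := hx.2.1
  push_cast at hsum
  obtain ⟨P, hK, hc, hB⟩ := st_exists (fun k => psum (N + 1) k x) (psum_zero _ x) N c (by omega)
    (fun j hj => psum_inc _ x hx.1 j (by omega)) (by linarith) (by linarith)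
  subst hK hc
  refine ⟨P, rfl, rfl, ?_, (scell_iff _ x).2 ⟨hx.1, hsum, hB⟩⟩
  intro k hk0 hk
  have g1 : 1 ≤ cnt U k := by rw [← hc1]; exact cnt_mono U hk0
  have hub := ((hx.2.2 k (by omega)).1 g1).2
  have hlb : ((st P).lo k : ℝ) ≤ psum ((st P).K + 1) k x := by
    obtain ⟨g1, g2⟩ := hB k hk
    rcases Nat.lt_or_ge ((st P).lo k) ((st P).hi k) with h | h
    · exact (g1 h).1.le
    · exact (g2 (le_antisymm ((inv_st P).le _) h)).ge
  exact_mod_cast lt_of_le_of_lt hlb hub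

theorem main_zero (r : ℕ) (U : Finset ℕ) (hUsub : U ⊆ Finset.Icc 1 0) (hUcard : U.card = r) :
    ∃ (m : ℕ) (N : Fin m → Finset (Finset ℕ)),
      (∀ j, IsBasisFamily (Finset.Icc 1 0) (N j) ∧
        IsDirectSumOfSeriesParallel (Finset.Icc 1 0) (N j)) ∧
      (∀ x : ↑(Finset.Icc 1 0) → ℝ,
        relintInd (Finset.Icc 1 0) (schubertBases 0 r U) x
          = ∑ j, relintInd (Finset.Icc 1 0) (N j) x) ∧
      (∀ i : ℕ, 1 ≤ i →
        (Finset.univ.filter fun j : Fin m =>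
            numComponents (Finset.Icc 1 0) (N j) = i).card
          = {P : List DStep | IsAdmissible 0 r U P ∧ diagCount P = i - 1}.ncard) := by
  have hI : Finset.Icc 1 0 = (∅ : Finset ℕ) := by simp
  have hU0 : U = ∅ := by rw [hI] at hUsub; exact Finset.subset_empty.1 hUsub
  subst hU0
  simp only [Finset.card_empty] at hUcard
  subst hUcard
  have hS : schubertBases 0 0 ∅ = {∅} := by
    rw [schubert_eq_Fam 0 0 ∅ (by simp) rfl]
    ext B
    rw [mem_Fam, hI, Finset.mem_singleton, Finset.subset_empty]
    constructor
    · exact fun h => h.1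
    · rintro rfl; simp
  refine ⟨1, fun _ => schubertBases 0 0 ∅, fun _ => ⟨?_, ?_⟩, fun x => by simp, fun i hi => ?_⟩
  · rw [hS]; refine ⟨by simp, by simp, by simp⟩
  · rw [hS, hI]; exact DS.empty.isDS
  · rw [hS, hI]; simp only [DS.empty.num]
    have : {P : List DStep | IsAdmissible 0 0 ∅ P ∧ diagCount P = i - 1} = ∅ := by
      ext P
      simp only [Set.mem_ofPred_eq, Set.mem_empty_iff_false, iff_false]
      rintro ⟨⟨⟨h, _⟩, _⟩, _⟩
      have := congrArg Prod.fst h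
      simp [pathPos] at this
    rw [this, Set.ncard_empty, Finset.card_eq_zero, Finset.filter_eq_empty_iff]
    intro j _
    omega

theorem main_pos (n r : ℕ) (U : Finset ℕ) (hUsub : U ⊆ Finset.Icc 1 n)
    (hUcard : U.card = r) (h1 : 1 ∈ U) (hn : n ∉ U) (hr1 : 1 ≤ r) (hrn : r < n) :
    ∃ (m : ℕ) (N : Fin m → Finset (Finset ℕ)),
      (∀ j, IsBasisFamily (Finset.Icc 1 n) (N j) ∧
        IsDirectSumOfSeriesParallel (Finset.Icc 1 n) (N j)) ∧
      (∀ x : ↑(Finset.Icc 1 n) → ℝ,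
        relintInd (Finset.Icc 1 n) (schubertBases n r U) x
          = ∑ j, relintInd (Finset.Icc 1 n) (N j) x) ∧
      (∀ i : ℕ, 1 ≤ i →
        (Finset.univ.filter fun j : Fin m =>
            numComponents (Finset.Icc 1 n) (N j) = i).card
          = {P : List DStep | IsAdmissible n r U P ∧ diagCount P = i - 1}.ncard) := by
  have hadm := admissible_iff n r U h1 hn hrn.le
  have hfin : {P : List DStep | IsAdmissible n r U P}.Finite := by
    refine (List.finite_length_le DStep n).subset fun P hP => ?_
    have := (hadm P).1 hP
    have := length_le_st P
    simp only [Set.mem_ofPred_eq]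
    omega
  set S := hfin.toFinset with hSdef
  have hS : ∀ P, P ∈ S ↔ IsAdmissible n r U P := fun P => by simp [hSdef]
  have hDS : ∀ P ∈ S, DS (Finset.Icc 1 n) (famSt (st P)) (diagCount P + 1) := by
    intro P hP
    have h := (hadm P).1 ((hS P).1 hP)
    have := ds_st P
    rwa [h.1] at this
  have hrel : ∀ P ∈ S, ∀ x : ↑(Finset.Icc 1 n) → ℝ,
      x ∈ intrinsicInterior ℝ (basePolytope (Finset.Icc 1 n) (famSt (st P))) ↔
        SCell n r (st P).lo (st P).hi x := by
    intro P hP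
    obtain ⟨hK, hc, _⟩ := (hadm P).1 ((hS P).1 hP)
    subst hK hc
    exact relint_st P
  have hrelM : ∀ x : ↑(Finset.Icc 1 n) → ℝ,
      x ∈ intrinsicInterior ℝ (basePolytope (Finset.Icc 1 n) (schubertBases n r U)) ↔
        SCell n r (fun _ => 0) (cnt U) x := by
    obtain ⟨x0, hx0⟩ := slater_schubert n r U hUsub hUcard h1 hn hr1 hrn
    rw [schubert_eq_Fam n r U hUsub hUcard]
    exact relint_Fam n r _ _ (fun _ _ => Nat.zero_le _) x0 hx0
  refine ⟨S.card, fun j => famSt (st (S.equivFin.symm j : List DStep)), fun j => ?_, fun x => ?_,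
    fun i hi => ?_⟩
  · have hP := (S.equivFin.symm j).2
    have h := hDS _ hP
    refine ⟨?_, h.isDS⟩
    have hK := ((hadm _).1 ((hS _).1 hP)).1
    have hh : IsBasisFamily (Finset.Icc 1 ((st (S.equivFin.symm j : List DStep)).K + 1))
        (famSt (st (S.equivFin.symm j : List DStep))) :=
      isBasisFamily_Fam _ _ _ _ (show (Fam ((st (S.equivFin.symm j : List DStep)).K + 1)
      ((st (S.equivFin.symm j : List DStep)).c + 1) _ _).Nonempty from h.ne)
    rw [hK] at hh
    exact hh
  · have hsum : ∑ j, relintInd (Finset.Icc 1 n) (famSt (st (S.equivFin.symm j : List DStep))) x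
        = ∑ P ∈ S, relintInd (Finset.Icc 1 n) (famSt (st P)) x := by
      rw [Equiv.sum_comp S.equivFin.symm
        (fun P : S => relintInd (Finset.Icc 1 n) (famSt (st (P : List DStep))) x)]
      exact Finset.sum_coe_sort S (fun P => relintInd (Finset.Icc 1 n) (famSt (st P)) x)
    rw [hsum]
    unfold relintInd
    by_cases hx : SCell n r (fun _ => 0) (cnt U) x
    · rw [if_pos ((hrelM x).2 hx)]
      obtain ⟨P, hK, hc, hlow, hcell⟩ := scell_exists n r U h1 hr1 hrn x hx
      have hPS : P ∈ S := (hS P).2 ((hadm P).2 ⟨hK, hc, hlow⟩)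
      rw [Finset.sum_eq_single_of_mem P hPS, if_pos ((hrel P hPS x).2 hcell)]
      intro Q hQ hQP
      rw [if_neg]
      intro hQx
      have hQcell := (hrel Q hQ x).1 hQx
      obtain ⟨hK', hc', hlow'⟩ := (hadm Q).1 ((hS Q).1 hQ)
      refine hQP (st_unique Q P (fun k => psum n k x) (by omega) (by omega) ?_ ?_)
      · intro k hk; exact hQcell.2.2 k (by omega)
      · intro k hk; exact hcell.2.2 k (by omega)
    · rw [if_neg (fun h => hx ((hrelM x).1 h))]
      symm
      refine Finset.sum_eq_zero fun P hP => ?_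
      rw [if_neg]
      intro hPx
      obtain ⟨hK, hc, hlow⟩ := (hadm P).1 ((hS P).1 hP)
      exact hx (scell_mono n r U h1 P hK hc hlow x ((hrel P hP x).1 hPx))
  · have hset : {P : List DStep | IsAdmissible n r U P ∧ diagCount P = i - 1}
        = ↑(S.filter fun P => diagCount P = i - 1) := by
      ext P
      simp [hS]
    rw [hset, Set.ncard_coe_finset]
    refine Finset.card_bij (fun j _ => (S.equivFin.symm j : List DStep)) ?_ ?_ ?_
    · intro j hj
      have hP := (S.equivFin.symm j).2
      have hj' := (Finset.mem_filter.1 hj).2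
      rw [(hDS _ hP).num] at hj'
      exact Finset.mem_filter.2 ⟨hP, by omega⟩
    · intro j _ j' _ h
      exact S.equivFin.symm.injective (Subtype.ext h)
    · intro P hP
      obtain ⟨hPS, hd⟩ := Finset.mem_filter.1 hP
      refine ⟨S.equivFin ⟨P, hPS⟩, ?_, by simp⟩
      refine Finset.mem_filter.2 ⟨Finset.mem_univ _, ?_⟩
      simp only [Equiv.symm_apply_apply]
      rw [(hDS P hPS).num]
      omega

theorem main_all (n r : ℕ) (U : Finset ℕ) (hUsub : U ⊆ Finset.Icc 1 n)
    (hUcard : U.card = r)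
    (hloopless : ∀ e ∈ Finset.Icc 1 n, ∃ B ∈ schubertBases n r U, e ∈ B)
    (hcoloopless : ∀ e ∈ Finset.Icc 1 n, ∃ B ∈ schubertBases n r U, e ∉ B) (hn0 : 0 < n) :
    1 ∈ U ∧ n ∉ U ∧ 1 ≤ r ∧ r < n := by
  rw [schubert_eq_Fam n r U hUsub hUcard] at hloopless hcoloopless
  obtain ⟨N, rfl⟩ : ∃ N, n = N + 1 := ⟨n - 1, by omega⟩
  obtain ⟨B, hB, heB⟩ := hloopless 1 (by simp)
  obtain ⟨B', hB', heB'⟩ := hcoloopless (N + 1) (by simp)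
  obtain ⟨s1, c1, b1⟩ := mem_Fam.1 hB
  obtain ⟨s2, c2, b2⟩ := mem_Fam.1 hB'
  have hnU : N + 1 ∉ U := by
    intro h
    have e1 := (mem_iff_cnt U N).1 h
    have e2 := cnt_eq_card U _ hUsub
    have e3 := cnt_eq_card B' _ (sub_Icc_pred s2 heB')
    have := (b2 N (by omega)).2
    omega
  have hU1 := sub_Icc_pred hUsub hnU
  have hcard := Finset.card_le_card hU1
  rw [Nat.card_Icc] at hcard
  have hr1 : 1 ≤ r := by rw [← c1]; exact Finset.card_pos.2 ⟨1, heB⟩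
  refine ⟨?_, hnU, hr1, by omega⟩
  have e1 := (mem_iff_cnt B 0).1 (by simpa using heB)
  have := (b1 1 (by omega)).2
  by_contra hh
  have e2 := cnt_succ U 0
  rw [if_neg (by simpa using hh)] at e2
  simp only [cnt_zero, zero_add] at e1 e2
  omega

theorem main_statement (n r : ℕ) (U : Finset ℕ) (hUsub : U ⊆ Finset.Icc 1 n)
    (hUcard : U.card = r)
    (hloopless : ∀ e ∈ Finset.Icc 1 n, ∃ B ∈ schubertBases n r U, e ∈ B)
    (hcoloopless : ∀ e ∈ Finset.Icc 1 n, ∃ B ∈ schubertBases n r U, e ∉ B) :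
    ∃ (m : ℕ) (N : Fin m → Finset (Finset ℕ)),
      (∀ j, IsBasisFamily (Finset.Icc 1 n) (N j) ∧
        IsDirectSumOfSeriesParallel (Finset.Icc 1 n) (N j)) ∧
      (∀ x : ↑(Finset.Icc 1 n) → ℝ,
        relintInd (Finset.Icc 1 n) (schubertBases n r U) x
          = ∑ j, relintInd (Finset.Icc 1 n) (N j) x) ∧
      (∀ i : ℕ, 1 ≤ i →
        (Finset.univ.filter fun j : Fin m =>
            numComponents (Finset.Icc 1 n) (N j) = i).card
          = {P : List DStep | IsAdmissible n r U P ∧ diagCount P = i - 1}.ncard) := by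
  rcases Nat.eq_zero_or_pos n with rfl | hn0
  · exact main_zero r U hUsub hUcard
  · obtain ⟨h1, hn, hr1, hrn⟩ := main_all n r U hUsub hUcard hloopless hcoloopless hn0
    exact main_pos n r U hUsub hUcard h1 hn hr1 hrn

/-- For a loopless and coloopless Schubert matroid `SM(U)` on `[n]` of
rank `r`, there is a finite family `N_1, …, N_m` of matroids on `[n]`, each a direct sum
of series-parallel matroids, such that the indicator function of the relative interior of
`P(SM(U))` is the sum of the indicator functions of the relative interiors of the
`P(N_j)`, and for each `i ≥ 1` the number of `j` with `c(N_j) = i` equals the number of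
admissible Delannoy paths associated to `SM(U)` with exactly `i - 1` diagonal steps. -/
theorem statement0 (n r : ℕ) (U : Finset ℕ) (hUsub : U ⊆ Finset.Icc 1 n)
    (hUcard : U.card = r)
    (hloopless : ∀ e ∈ Finset.Icc 1 n, ∃ B ∈ schubertBases n r U, e ∈ B)
    (hcoloopless : ∀ e ∈ Finset.Icc 1 n, ∃ B ∈ schubertBases n r U, e ∉ B) :
    ∃ (m : ℕ) (N : Fin m → Finset (Finset ℕ)),
      (∀ j, IsBasisFamily (Finset.Icc 1 n) (N j) ∧
        IsDirectSumOfSeriesParallel (Finset.Icc 1 n) (N j)) ∧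
      (∀ x : ↑(Finset.Icc 1 n) → ℝ,
        relintInd (Finset.Icc 1 n) (schubertBases n r U) x
          = ∑ j, relintInd (Finset.Icc 1 n) (N j) x) ∧
      (∀ i : ℕ, 1 ≤ i →
        (Finset.univ.filter fun j : Fin m =>
            numComponents (Finset.Icc 1 n) (N j) = i).card
          = {P : List DStep | IsAdmissible n r U P ∧ diagCount P = i - 1}.ncard) := by
  exact main_statement n r U hUsub hUcard hloopless hcoloopless
end GPoly
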